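/- Let A = kQ/I be a non simply connected toupie algebra with m = dim_k e_0 A e_∞ = 1 such that exactly one branch of Q lies in the ideal I. Then A is a laura algebra. -/

import Mathlib

/-!
Formalization preamble for "Toupie algebras".

We realize the bound quiver algebra `A = kQ/I` of a toupie quiver `Q` concretely:
the path algebra `kQ` is realized, via its (faithful) left regular representation,
as the subalgebra of `Module.End k (paths → k)` generated by the operators of left
multiplication by the trivial paths `e_v` and by the arrows of `Q`.  Paths are
composed from left to right (`p * q` = "first `p`, then `q`"), as in
Assem–Simson–Skowroński, so that paths from the source `0` to the sink `∞` span
`e₀ (kQ) e∞`, and (right) `A`-modules are identified with representations of `(Q, I)`.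
Right `A`-modules are formalized as (left) modules over `Aᵐᵒᵖ`.
-/

set_option synthInstance.maxHeartbeats 400000
set_option maxHeartbeats 800000

noncomputable section
open scoped Classical
open MulOpposite

universe u

namespace Toupie

/-- Vertices of a toupie quiver with `t` branches, branch `i` having length `ℓ i ≥ 1`:
the unique source `src`, the unique sink `snk`, and for each branch `i` its interior
vertices `mid i a` (the `(a+1)`-st vertex on branch `i`, for `a : Fin (ℓ i - 1)`). -/
inductive Vtx (t : ℕ) (ℓ : Fin t → ℕ) : Type
  | src : Vtx t ℓ
  | snk : Vtx t ℓ
  | mid (i : Fin t) (a : Fin (ℓ i - 1)) : Vtx t ℓ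

/-- The `a`-th vertex on branch `i`, for `0 ≤ a ≤ ℓ i`
(`a = 0` is the source, `a = ℓ i` is the sink). -/
def vtx (t : ℕ) (ℓ : Fin t → ℕ) (i : Fin t) (a : ℕ) : Vtx t ℓ :=
  if a = 0 then .src else if h : a - 1 < ℓ i - 1 then .mid i ⟨a - 1, h⟩ else .snk

/-- The paths of a toupie quiver: trivial paths at the vertices, and for each branch
`i` and `a < b ≤ ℓ i` the path `sub i a b` along branch `i` from its `a`-th vertex to
its `b`-th vertex.  (`sub i 0 (ℓ i)` is the `i`-th branch `w i`.) -/
inductive PIdx (t : ℕ) (ℓ : Fin t → ℕ) : Type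
  | vert (v : Vtx t ℓ) : PIdx t ℓ
  | sub (i : Fin t) (a b : ℕ) (hab : a < b) (hb : b ≤ ℓ i) : PIdx t ℓ

variable (k : Type u) [Field k] (t : ℕ) (ℓ : Fin t → ℕ)

/-- The vector space with basis the set of paths of the toupie quiver. -/
abbrev PSp : Type u := PIdx t ℓ → k

variable {t ℓ}

/-- The starting vertex of a path. -/
def startIdx : PIdx t ℓ → Vtx t ℓ
  | .vert v => v
  | .sub i a _ _ _ => vtx t ℓ i a

/-- Left multiplication by the trivial path (primitive idempotent) `e_v`. -/
def Ev (v : Vtx t ℓ) : Module.End k (PSp k t ℓ) where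
  toFun f := fun p => if startIdx p = v then f p else 0
  map_add' f g := by funext p; by_cases h : startIdx p = v <;> simp [h]
  map_smul' c f := by funext p; by_cases h : startIdx p = v <;> simp [h]

/-- Strip the `j`-th arrow of branch `i` (the arrow `vtx i j ⟶ vtx i (j+1)`) from the
front of a path, if possible. -/
def strip (i : Fin t) (j : ℕ) : PIdx t ℓ → Option (PIdx t ℓ)
  | .vert _ => none
  | .sub i' a b _ hb =>
      if h : i' = i ∧ a = j then
        if hb2 : j + 1 < b then some (.sub i (j + 1) b hb2 (h.1 ▸ hb))
        else some (.vert (vtx t ℓ i b))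
      else none

/-- Left multiplication by the `j`-th arrow of branch `i`
(the arrow from `vtx i j` to `vtx i (j+1)`, for `j < ℓ i`; the zero operator for junk `j`). -/
def Ar (i : Fin t) (j : ℕ) : Module.End k (PSp k t ℓ) where
  toFun f := fun p => (strip i j p).elim 0 f
  map_add' f g := by funext p; rcases h : strip i j p with _ | q <;> simp [h]
  map_smul' c f := by funext p; rcases h : strip i j p with _ | q <;> simp [h]

variable (t ℓ)

/-- The generators of the path algebra: the trivial paths and the arrows. -/
def gens : Set (Module.End k (PSp k t ℓ)) :=
  Set.range (Ev k) ∪ {x | ∃ i j, x = Ar k i j}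

/-- The path algebra `kQ` of the toupie quiver, realized as the subalgebra of
`Module.End k (PSp k t ℓ)` generated by left multiplication by trivial paths and arrows. -/
def PathAlg : Subalgebra k (Module.End k (PSp k t ℓ)) :=
  Algebra.adjoin k (gens k t ℓ)

variable {k t ℓ}

/-- The trivial path `e_v` as an element of the path algebra. -/
def eV (v : Vtx t ℓ) : PathAlg k t ℓ :=
  ⟨Ev k v, Algebra.subset_adjoin (Or.inl ⟨v, rfl⟩)⟩

/-- The `j`-th arrow of branch `i` as an element of the path algebra. -/
def arE (i : Fin t) (j : ℕ) : PathAlg k t ℓ :=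
  ⟨Ar k i j, Algebra.subset_adjoin (Or.inr ⟨i, j, rfl⟩)⟩

/-- The path along branch `i` from its `a`-th vertex to its `b`-th vertex, as an element
of the path algebra: the product (composed from left to right) of the arrows
`a → a+1 → ⋯ → b`.  (For `b ≤ a` this is the empty product `1`.) -/
def subE (i : Fin t) (a b : ℕ) : PathAlg k t ℓ :=
  (((List.range (b - a)).map fun s => arE i (a + s)).prod)

/-- The `i`-th branch `w i` (the path from the source to the sink along branch `i`)
as an element of the path algebra. -/
def wE (i : Fin t) : PathAlg k t ℓ := subE i 0 (ℓ i)

variable {k : Type u} [Field k]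

/-- A toupie algebra `A = kQ/I`: a toupie quiver `Q` (a non-linear quiver with a unique
source, a unique sink, and all other vertices having exactly one incoming and one
outgoing arrow, i.e. `t ≥ 2` branches of lengths `ℓ i ≥ 1`), together with an admissible
ideal `I` of the path algebra `kQ`.  Since `Q` is finite and acyclic, the arrow ideal is
nilpotent, so admissibility amounts to `I ⊆ R_Q²`, i.e. every element of `I` is a linear
combination of paths of length `≥ 2`. -/
structure ToupieAlg (k : Type u) [Field k] : Type u where
  t : ℕ
  ht : 2 ≤ t
  ℓ : Fin t → ℕ
  hℓ : ∀ i, 1 ≤ ℓ i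
  I : TwoSidedIdeal (PathAlg k t ℓ)
  adm : ∀ x ∈ I, x ∈ Submodule.span k
    {y : PathAlg k t ℓ | ∃ i a b, a + 2 ≤ b ∧ b ≤ ℓ i ∧ y = subE i a b}

variable (T : ToupieAlg k)

/-- The underlying algebra `A = kQ/I` of a toupie algebra. -/
def Alg : Type u := T.I.ringCon.Quotient

instance : Ring (Alg T) := inferInstanceAs (Ring T.I.ringCon.Quotient)

/-- The quotient map `kQ → A = kQ/I`. -/
def mkA : PathAlg k T.t T.ℓ →+* Alg T := T.I.ringCon.mk'

lemma mkA_surjective : Function.Surjective (mkA T) := Quotient.mk''_surjective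

instance : Algebra k (Alg T) :=
  RingHom.toAlgebra' ((mkA T).comp (algebraMap k (PathAlg k T.t T.ℓ)))
    (by
      intro c x
      obtain ⟨y, rfl⟩ := mkA_surjective T x
      simp only [RingHom.coe_comp, Function.comp_apply, ← map_mul]
      rw [Algebra.commutes])

/-- The idempotent `e₀` (at the source) in `A`. -/
def e0 : Alg T := mkA T (eV Vtx.src)

/-- The idempotent `e∞` (at the sink) in `A`. -/
def einf : Alg T := mkA T (eV Vtx.snk)

/-- The `k`-linear map `A → A`, `x ↦ e₀ * x * e∞`, whose range is `e₀ A e∞`. -/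
def lrMap : Alg T →ₗ[k] Alg T where
  toFun x := e0 T * x * einf T
  map_add' x y := by simp [mul_add, add_mul]
  map_smul' c x := by
    simp only [RingHom.id_apply]
    rw [mul_smul_comm, smul_mul_assoc]

/-- `m = dim_k e₀ A e∞`, the dimension of the span of the (residues of the) paths from
the source to the sink. -/
def mDim : ℕ := Module.finrank k ↥(LinearMap.range (lrMap T))

/-- The branch `w i` lies in the ideal `I`. -/
def branchInI (i : Fin T.t) : Prop := wE i ∈ T.I

/-- A minimal relation: `∑_{i ∈ J} λ i • w i ∈ I` with `|J| ≥ 2`, all `λ i ≠ 0`, and no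
nonempty proper subsum in `I`. -/
def MinRel (J : Finset (Fin T.t)) (lam : Fin T.t → k) : Prop :=
  2 ≤ J.card ∧ (∀ i ∈ J, lam i ≠ 0) ∧ (∑ i ∈ J, lam i • wE i) ∈ T.I ∧
    ∀ J' ⊂ J, J'.Nonempty → (∑ i ∈ J', lam i • wE i) ∉ T.I

/-- A toupie algebra is simply connected if any two distinct branches are involved in a
common minimal relation. -/
def SimplyConnected : Prop :=
  ∀ i j : Fin T.t, i ≠ j → ∃ J lam, MinRel T J lam ∧ i ∈ J ∧ j ∈ J

/-- A (minimal) zero-relation on branch `i`: the subpath of branch `i` from its `a`-th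
to its `b`-th vertex lies in `I`, but no proper subpath of it does. -/
def ZeroRel (i : Fin T.t) (a b : ℕ) : Prop :=
  a < b ∧ b ≤ T.ℓ i ∧ subE i a b ∈ T.I ∧
    ∀ a' b', a ≤ a' → b' ≤ b → a' < b' → (a', b') ≠ (a, b) → subE i a' b' ∉ T.I

/-- There is exactly one relation on branch `i`. -/
def ExactlyOneRel (i : Fin T.t) : Prop := ∃! p : ℕ × ℕ, ZeroRel T i p.1 p.2

/-- Branch `i` carries more than one relation. -/
def MoreThanOneRel (i : Fin T.t) : Prop :=
  ∃ p q : ℕ × ℕ, p ≠ q ∧ ZeroRel T i p.1 p.2 ∧ ZeroRel T i q.1 q.2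

/-- At most one branch of `Q` has length at least three. -/
def AtMostOneLongBranch : Prop := ∀ i j : Fin T.t, 3 ≤ T.ℓ i → 3 ≤ T.ℓ j → i = j

/-- The two-sided ideal `I` is generated by the set `S`. -/
def IsGenBy {R : Type u} [Ring R] (I : TwoSidedIdeal R) (S : Set R) : Prop :=
  S ⊆ (I : Set R) ∧ ∀ J : TwoSidedIdeal R, S ⊆ (J : Set R) → (I : Set R) ⊆ (J : Set R)

/-- A toupie algebra is canonical if (after choosing two distinguished branches `i₁, i₂`)
its ideal is generated by `{w i₁ + λ j • w i₂ - w j}` over the remaining branches `j`,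
with the `λ j` pairwise distinct and nonzero. -/
def IsCanonical : Prop :=
  ∃ (i₁ i₂ : Fin T.t) (lam : Fin T.t → k), i₁ ≠ i₂ ∧
    (∀ j, j ≠ i₁ → j ≠ i₂ → lam j ≠ 0) ∧
    (∀ j j', j ≠ i₁ → j ≠ i₂ → j' ≠ i₁ → j' ≠ i₂ → j ≠ j' → lam j ≠ lam j') ∧
    IsGenBy T.I {x | ∃ j, j ≠ i₁ ∧ j ≠ i₂ ∧ x = wE i₁ + lam j • wE i₂ - wE j}

end Toupie
namespace Toupie

/-! ### Module-theoretic notions over an arbitrary ring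

Following the paper, all modules are finite-dimensional *right* modules; a right
`A`-module is formalized as a (left) module over `Aᵐᵒᵖ`.  The definitions below are
stated for modules over an arbitrary ring `R` and are applied with `R := Aᵐᵒᵖ`. -/

variable (R : Type u) [Ring R]

/-- A module is indecomposable if it is nonzero and its only idempotent endomorphisms
are `0` and the identity. -/
def Indec (M : ModuleCat.{u} R) : Prop :=
  Nontrivial M ∧ ∀ f : M →ₗ[R] M, f.comp f = f → f = 0 ∨ f = LinearMap.id

/-- Finiteness ("finite dimensionality") of a module. -/
def FdMod (M : ModuleCat.{u} R) : Prop := Module.Finite R M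

/-- `M` has projective dimension at most one: it is the quotient of a projective module
by a projective submodule. -/
def PdLeOne (M : ModuleCat.{u} R) : Prop :=
  ∃ (P : ModuleCat.{u} R) (f : P →ₗ[R] M), Function.Surjective f ∧
    Module.Projective R P ∧ Module.Projective R ↥(LinearMap.ker f)

/-- `M` has injective dimension at most one: it embeds in an injective module with
injective cokernel. -/
def IdLeOne (M : ModuleCat.{u} R) : Prop :=
  ∃ (E : ModuleCat.{u} R) (f : M →ₗ[R] E), Function.Injective f ∧
    Module.Injective R E ∧ Module.Injective R (E ⧸ LinearMap.range f)

/-- One step of a path in `ind R`: a nonzero non-isomorphism between (finite-dimensional)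
indecomposable modules. -/
def Step (M N : ModuleCat.{u} R) : Prop :=
  Indec R M ∧ FdMod R M ∧ Indec R N ∧ FdMod R N ∧
    ∃ f : M →ₗ[R] N, f ≠ 0 ∧ ¬ Function.Bijective f

/-- A path in `ind R` from `M` to `N` (possibly trivial): a chain
`M = M₀ → M₁ → ⋯ → Mₙ = N` of nonzero non-isomorphisms between indecomposables. -/
def IndPath (M N : ModuleCat.{u} R) : Prop := Relation.ReflTransGen (Step R) M N

/-- The left part `L_R`: the indecomposable (finite-dimensional) modules `M` such that
every indecomposable `X` with a path `X ⇝ M` in `ind R` has projective dimension `≤ 1`. -/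
def InLeftPart (M : ModuleCat.{u} R) : Prop :=
  Indec R M ∧ FdMod R M ∧
    ∀ X : ModuleCat.{u} R, Indec R X → FdMod R X → IndPath R X M → PdLeOne R X

/-- The right part `R_R`: the indecomposable (finite-dimensional) modules `M` such that
every indecomposable `X` with a path `M ⇝ X` in `ind R` has injective dimension `≤ 1`. -/
def InRightPart (M : ModuleCat.{u} R) : Prop :=
  Indec R M ∧ FdMod R M ∧
    ∀ X : ModuleCat.{u} R, Indec R X → FdMod R X → IndPath R M X → IdLeOne R X

/-- Hereditary: global dimension at most one, i.e. every module has projective dimension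
at most one. -/
def Hereditary : Prop := ∀ M : ModuleCat.{u} R, PdLeOne R M

/-- Quasitilted: every indecomposable projective module lies in the left part. -/
def Quasitilted : Prop :=
  ∀ P : ModuleCat.{u} R, Indec R P → FdMod R P → Module.Projective R P → InLeftPart R P

/-- A module is directed if it lies on no cycle of nonzero non-isomorphisms between
indecomposables in `ind R`. -/
def Directed (M : ModuleCat.{u} R) : Prop := ¬ Relation.TransGen (Step R) M M

/-- Weakly shod: every indecomposable (finite-dimensional) module not lying in
`L_R ∪ R_R` is directed. -/
def WeaklyShod : Prop :=
  ∀ M : ModuleCat.{u} R, Indec R M → FdMod R M →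
    ¬ InLeftPart R M → ¬ InRightPart R M → Directed R M

/-- Laura: all but finitely many isomorphism classes of indecomposable
(finite-dimensional) modules lie in `L_R ∪ R_R`. -/
def Laura : Prop :=
  ∃ S : Set (ModuleCat.{u} R), S.Finite ∧
    ∀ M : ModuleCat.{u} R, Indec R M → FdMod R M →
      ¬ InLeftPart R M → ¬ InRightPart R M → ∃ N ∈ S, Nonempty (M ≃ₗ[R] N)

/-- There are exactly `n` isomorphism classes of modules satisfying `P`. -/
def NumClasses (P : ModuleCat.{u} R → Prop) (n : ℕ) : Prop :=
  ∃ f : Fin n → ModuleCat.{u} R, (∀ i, P (f i)) ∧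
    (∀ i j, Nonempty ((f i : Type u) ≃ₗ[R] (f j : Type u)) → i = j) ∧
    ∀ M : ModuleCat.{u} R, P M → ∃ i, Nonempty ((M : Type u) ≃ₗ[R] (f i : Type u))

/-- `M` is (isomorphic to) a direct summand of `T`. -/
def IsSummandOf (T : Type u) [AddCommGroup T] [Module R T] (M : ModuleCat.{u} R) : Prop :=
  ∃ N N' : Submodule R T, IsCompl N N' ∧ Nonempty ((M : Type u) ≃ₗ[R] N)

/-- `Ext¹_R(T, T) = 0`: every self-extension `0 → T → E → T → 0` splits. -/
def SelfExtVanish (T : Type u) [AddCommGroup T] [Module R T] : Prop :=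
  ∀ (E : Type u) [AddCommGroup E] [Module R E] (ι : T →ₗ[R] E) (π : E →ₗ[R] T),
    Function.Injective ι → Function.Surjective π → LinearMap.range ι = LinearMap.ker π →
      ∃ s : T →ₗ[R] E, π.comp s = LinearMap.id

/-- A tilting module over a hereditary algebra: a finite module with `Ext¹(T,T) = 0`
having as many pairwise non-isomorphic indecomposable direct summands as there are
simple modules. -/
def IsTiltingMod (T : Type u) [AddCommGroup T] [Module R T] : Prop :=
  Module.Finite R T ∧ SelfExtVanish R T ∧
    ∃ n : ℕ, NumClasses R (fun M => Indec R M ∧ IsSummandOf R T M) n ∧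
      NumClasses R (fun M => IsSimpleModule R M) n

variable (k : Type u) [Field k]

/-- A `k`-algebra `A` is tilted if it is the endomorphism algebra of a tilting (right)
module over a hereditary finite-dimensional `k`-algebra `H`.  (Right `H`-modules are
modules over `Hᵐᵒᵖ`; the isomorphism `A ≅ End_H T` is a `k`-linear ring isomorphism.) -/
def IsTilted (A : Type u) [Ring A] [Algebra k A] : Prop :=
  ∃ (H : Type u) (_ : Ring H) (_ : Algebra k H),
    FiniteDimensional k H ∧ Hereditary Hᵐᵒᵖ ∧
      ∃ (T : Type u) (_ : AddCommGroup T) (_ : Module Hᵐᵒᵖ T),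
        IsTiltingMod Hᵐᵒᵖ T ∧
          ∃ (_ : Module k T) (_ : SMulCommClass Hᵐᵒᵖ k T) (_ : IsScalarTower k Hᵐᵒᵖ T)
            (φ : A ≃+* Module.End Hᵐᵒᵖ T), ∀ (c : k) (x : A), φ (c • x) = c • φ x

end Toupie
namespace Toupie

variable {k : Type u} [Field k] (T : ToupieAlg k)

/-! ### Right `A`-modules as representations of `(Q, I)`

For a right `A`-module `M` (a module over `Aᵐᵒᵖ`) and a vertex `v`, the space of the
corresponding representation at `v` is `M_v = M • e_v`. -/

/-- The action of the idempotent `e_v ∈ A` on a right `A`-module (= `Aᵐᵒᵖ`-module). -/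
def actV (v : Vtx T.t T.ℓ) : (Alg T)ᵐᵒᵖ := op (mkA T (eV v))

/-- The space `M_v = M • e_v` of the representation `M` at the vertex `v` is zero. -/
def VanishAt (M : ModuleCat.{u} (Alg T)ᵐᵒᵖ) (v : Vtx T.t T.ℓ) : Prop :=
  ∀ m : M, actV T v • m = 0

/-- Every simple summand of `top M = M / rad M` is one of the simple modules `S_v`,
`v ∈ vs`: for every maximal submodule `N` the simple quotient `M/N` is supported at some
vertex of `vs` (for an admissible quotient of a path algebra, the simple module `S_v` is
the unique simple on which `e_v` acts nontrivially). -/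
def TopIn (M : ModuleCat.{u} (Alg T)ᵐᵒᵖ) (vs : Set (Vtx T.t T.ℓ)) : Prop :=
  ∀ N : Submodule (Alg T)ᵐᵒᵖ M, IsCoatom N → ∃ v ∈ vs, ∃ m : M, actV T v • m ∉ N

/-- Every simple summand of the socle of `M` is one of the simple modules `S_v`,
`v ∈ vs`: every simple submodule `N ≤ M` is supported at some vertex of `vs`. -/
def SocIn (M : ModuleCat.{u} (Alg T)ᵐᵒᵖ) (vs : Set (Vtx T.t T.ℓ)) : Prop :=
  ∀ N : Submodule (Alg T)ᵐᵒᵖ M, IsAtom N → ∃ v ∈ vs, ∃ m ∈ N, actV T v • m ≠ 0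

/-- The module `D x y` (for two positions `0 ≤ x, y ≤ ℓ i₀` on the unique branch `i₀`
lying in `I`, and an auxiliary branch `i₂ ≠ i₀`): the right `A`-module with generators
`g = e₀` (at the source) and `h = e_y` (at the `y`-th vertex of branch `i₀`), subject to
the relations `g ⬝ (subpath of w i₀ from 0 to x+1) = 0` and
`g ⬝ w i₂ = h ⬝ (subpath of w i₀ from y to ℓ i₀)`.  It is presented as the quotient of
the right regular module `A ⊕ A` by the right submodule generated by
`(1 - e₀, 0)`, `(0, 1 - e_y)`, `(subE i₀ 0 (min (x+1) (ℓ i₀)), 0)` and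
`(w i₂, - subE i₀ y (ℓ i₀))`. -/
abbrev Dmod (i₀ i₂ : Fin T.t) (x y : ℕ) : Type u :=
  (Alg T × Alg T) ⧸ Submodule.span (Alg T)ᵐᵒᵖ
    ({((mkA T (1 - eV Vtx.src) : Alg T), (0 : Alg T)),
      ((0 : Alg T), (mkA T (1 - eV (vtx T.t T.ℓ i₀ y)) : Alg T)),
      ((mkA T (subE i₀ 0 (min (x + 1) (T.ℓ i₀))) : Alg T), (0 : Alg T)),
      ((mkA T (wE i₂) : Alg T), (- mkA T (subE i₀ y (T.ℓ i₀)) : Alg T))} :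
        Set (Alg T × Alg T))

end Toupie

namespace Toupie

section LinearAlgebra

variable {k V V' W W' : Type*} [Field k] [AddCommGroup V] [Module k V] [AddCommGroup V']
  [Module k V'] [AddCommGroup W] [Module k W] [AddCommGroup W'] [Module k W']

/-- Simultaneous extension along a linear map and lifting along a surjection. -/
lemma exists_extend_lift (φ : V →ₗ[k] V') (p : V →ₗ[k] W) (g : V' →ₗ[k] W') (π : W →ₗ[k] W')
    (hπ : Function.Surjective π) (hc : ∀ x, π (p x) = g (φ x)) (hk : ∀ x, φ x = 0 → p x = 0) :
    ∃ h : V' →ₗ[k] W, (∀ x, h (φ x) = p x) ∧ ∀ x, π (h x) = g x := by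
  obtain ⟨s, hs⟩ := π.exists_rightInverse_of_surjective (LinearMap.range_eq_top.2 hπ)
  have hs' : ∀ x, π (s x) = x := fun x => LinearMap.congr_fun hs x
  obtain ⟨r, hr⟩ := φ.rangeRestrict.exists_rightInverse_of_surjective
    (LinearMap.range_eq_top.2 φ.surjective_rangeRestrict)
  have hr' : ∀ x, φ (r x) = x := fun x => congrArg Subtype.val (LinearMap.congr_fun hr x)
  obtain ⟨q, hq⟩ := LinearMap.exists_extend ((p - s ∘ₗ g ∘ₗ φ) ∘ₗ r)
  have hq' : ∀ x, q (φ x) = p x - s (g (φ x)) := by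
    intro x
    have h1 := LinearMap.congr_fun hq ⟨φ x, x, rfl⟩
    have h2 := hr' ⟨φ x, x, rfl⟩
    have h3 : p (r ⟨φ x, x, rfl⟩) = p x := by
      rw [← sub_eq_zero, ← map_sub]
      exact hk _ (by rw [map_sub, h2, sub_self])
    simp only [LinearMap.comp_apply, Submodule.subtype_apply, LinearMap.sub_apply, h2, h3] at h1
    exact h1
  refine ⟨s ∘ₗ g + (LinearMap.id - s ∘ₗ π) ∘ₗ q, fun x => ?_, fun x => ?_⟩
  · simp [hq', hc, hs']
  · simp [hs']

/-- Extension along an injection of a map which lifts a prescribed map. -/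
lemma exists_lift_extend (ι : V →ₗ[k] V') (g : V →ₗ[k] W) (φ : W →ₗ[k] W') (q : V' →ₗ[k] W')
    (hι : Function.Injective ι) (hc : ∀ x, q (ι x) = φ (g x))
    (hr : ∀ y, q y ∈ LinearMap.range φ) :
    ∃ h : V' →ₗ[k] W, (∀ x, h (ι x) = g x) ∧ ∀ y, φ (h y) = q y := by
  obtain ⟨h, h1, h2⟩ := exists_extend_lift ι g (q.codRestrict _ hr) φ.rangeRestrict
    φ.surjective_rangeRestrict (fun x => Subtype.ext (hc x).symm)
    (fun x hx => by rw [(map_eq_zero_iff ι hι).1 hx, map_zero])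
  exact ⟨h, h1, fun y => congrArg Subtype.val (h2 y)⟩

lemma exists_dual_eq_one {p : Submodule k V} {x : V} (hx : x ∉ p) :
    ∃ φ : V →ₗ[k] k, φ x = 1 ∧ ∀ y ∈ p, φ y = 0 := by
  obtain ⟨f, hf, hp⟩ := Submodule.exists_dual_map_eq_bot_of_notMem hx inferInstance
  refine ⟨(f x)⁻¹ • f, by simp [hf], fun y hy => ?_⟩
  have : f y ∈ p.map f := ⟨y, hy, rfl⟩
  rw [hp, Submodule.mem_bot] at this
  simp [this]

end LinearAlgebra

lemma exists_seq_up {α : Type*} (n : ℕ) (P : ℕ → α → α → Prop) (Q : ℕ → α → Prop)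
    (base : ∃ x, Q 0 x) (step : ∀ a < n, ∀ x, Q a x → ∃ y, Q (a + 1) y ∧ P a x y) :
    ∃ h : ℕ → α, (∀ a ≤ n, Q a (h a)) ∧ ∀ a < n, P a (h a) (h (a + 1)) := by
  obtain ⟨x₀, hx₀⟩ := base
  choose! s hs using step
  let h : ℕ → α := fun a => Nat.rec x₀ (fun b y => s b y) a
  have hQ : ∀ a ≤ n, Q a (h a) := by
    intro a
    induction a with
    | zero => exact fun _ => hx₀
    | succ b ih => exact fun hb => (hs b (by omega) (h b) (ih (by omega))).1
  exact ⟨h, hQ, fun a ha => (hs a ha (h a) (hQ a ha.le)).2⟩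

lemma exists_seq_down {α : Type*} (n : ℕ) (P : ℕ → α → α → Prop) (Q : ℕ → α → Prop)
    (base : ∃ x, Q n x) (step : ∀ a < n, ∀ y, Q (a + 1) y → ∃ x, Q a x ∧ P a x y) :
    ∃ h : ℕ → α, (∀ a ≤ n, Q a (h a)) ∧ ∀ a < n, P a (h a) (h (a + 1)) := by
  obtain ⟨h, h1, h2⟩ := exists_seq_up n (fun a x y => P (n - (a + 1)) y x)
    (fun a x => Q (n - a) x) (by simpa using base) (fun a ha x hx => by
      refine step (n - (a + 1)) (by omega) x ?_
      rwa [show n - (a + 1) + 1 = n - a by omega])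
  refine ⟨fun a => h (n - a), fun a ha => ?_, fun a ha => ?_⟩
  · simpa [Nat.sub_sub_self ha] using h1 (n - a) (by omega)
  · have := h2 (n - (a + 1)) (by omega)
    rwa [show n - (a + 1) + 1 = n - a by omega, show n - (n - a) = a by omega] at this

section Quiver

variable {t : ℕ} {ℓ : Fin t → ℕ}

instance : Finite (Vtx t ℓ) := by
  refine Finite.of_injective (β := Option (Option (Σ i, Fin (ℓ i - 1))))
    (fun v => match v with
      | .src => none
      | .snk => some none
      | .mid i a => some (some ⟨i, a⟩)) ?_
  rintro (_ | _ | ⟨i, a⟩) (_ | _ | ⟨j, b⟩) h <;> simp_all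

instance : Fintype (Vtx t ℓ) := Fintype.ofFinite _

lemma vtx_zero (i : Fin t) : vtx t ℓ i 0 = .src := rfl

lemma vtx_mid (i : Fin t) {a : ℕ} (h0 : 0 < a) (h : a < ℓ i) :
    vtx t ℓ i a = .mid i ⟨a - 1, by omega⟩ := by
  rw [vtx, if_neg (by omega), dif_pos]

lemma vtx_snk (i : Fin t) (hi : 1 ≤ ℓ i) : vtx t ℓ i (ℓ i) = .snk := by
  rw [vtx, if_neg (by omega), dif_neg (by omega)]

lemma vtx_mid_eq (i : Fin t) (a : Fin (ℓ i - 1)) : (.mid i a : Vtx t ℓ) = vtx t ℓ i (a + 1) := by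
  rw [vtx_mid i (by omega) (by omega)]
  rfl

lemma vtx_ne_src (i : Fin t) {a : ℕ} (h0 : 0 < a) : vtx t ℓ i a ≠ .src := by
  rw [vtx, if_neg (by omega)]
  split_ifs <;> simp

lemma vtx_ne_snk (i : Fin t) {a : ℕ} (h : a < ℓ i) : vtx t ℓ i a ≠ .snk := by
  rcases Nat.eq_zero_or_pos a with rfl | h0
  · simp [vtx_zero]
  · simp [vtx_mid i h0 h]

lemma vtx_inj {i j : Fin t} {a b : ℕ} (h0 : 0 < a) (h : a < ℓ i)
    (hb : b ≤ ℓ j) (hj : 1 ≤ ℓ j) (he : vtx t ℓ i a = vtx t ℓ j b) : i = j ∧ a = b := by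
  rcases Nat.eq_zero_or_pos b with rfl | hb0
  · exact absurd he (vtx_ne_src i h0)
  rcases hb.lt_or_eq with hb | rfl
  · rw [vtx_mid i h0 h, vtx_mid j hb0 hb] at he
    simp only [Vtx.mid.injEq] at he
    obtain ⟨rfl, he⟩ := he
    simp only [heq_eq_eq, Fin.mk.injEq] at he
    exact ⟨rfl, by omega⟩
  · rw [vtx_snk j hj] at he
    exact absurd he (vtx_ne_snk i h)

variable (k : Type u) [Field k]

lemma Ev_mul_Ev (v v' : Vtx t ℓ) : Ev k v * Ev k v' = if v = v' then Ev k v else 0 := by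
  ext f p
  by_cases h : v = v'
  · subst h
    by_cases hp : startIdx p = v <;> simp [Ev, hp]
  · by_cases hp : startIdx p = v
    · have : startIdx p ≠ v' := fun h' => h (hp.symm.trans h')
      simp [Ev, h, this]
    · simp [Ev, h, hp]

lemma sum_Ev : ∑ v : Vtx t ℓ, Ev k v = 1 := by
  ext f p
  simp [Ev, LinearMap.sum_apply, Finset.sum_apply]

lemma Ar_eq_zero (i : Fin t) {j : ℕ} (hj : ℓ i ≤ j) : Ar (ℓ := ℓ) k i j = 0 := by
  ext f p
  have : strip i j p = none := by
    rcases p with v | ⟨i', a, b, hab, hb⟩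
    · rfl
    · rw [strip, dif_neg]
      rintro ⟨rfl, rfl⟩
      omega
  simp [Ar, this]

lemma strip_eq_some {i : Fin t} {j : ℕ} {p q : PIdx t ℓ} (h : strip i j p = some q) :
    startIdx p = vtx t ℓ i j ∧ startIdx q = vtx t ℓ i (j + 1) := by
  rcases p with v | ⟨i', a, b, hab, hb⟩
  · simp [strip] at h
  · rw [strip] at h
    split_ifs at h with h1 h2
    · obtain ⟨rfl, rfl⟩ := h1
      simp only [Option.some.injEq] at h
      subst h
      exact ⟨rfl, rfl⟩
    · obtain ⟨rfl, rfl⟩ := h1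
      simp only [Option.some.injEq] at h
      subst h
      have : b = a + 1 := by omega
      subst this
      exact ⟨rfl, rfl⟩

lemma Ev_mul_Ar (i : Fin t) (j : ℕ) : Ev k (vtx t ℓ i j) * Ar k i j = Ar k i j := by
  ext f p
  rcases h : strip i j p with _ | q
  · simp [Ar, Ev, h]
  · simp [Ar, Ev, h, (strip_eq_some h).1]

lemma Ar_mul_Ev (i : Fin t) (j : ℕ) : Ar k i j * Ev k (vtx t ℓ i (j + 1)) = Ar k i j := by
  ext f p
  rcases h : strip i j p with _ | q
  · simp [Ar, h]
  · simp [Ar, Ev, h, (strip_eq_some h).2]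

end Quiver

end Toupie

namespace Toupie

section Action

variable {k : Type u} [Field k] (T : ToupieAlg k)

lemma mkA_smul (c : k) (x : PathAlg k T.t T.ℓ) : mkA T (c • x) = c • mkA T x := by
  rw [Algebra.smul_def, Algebra.smul_def, map_mul]
  rfl

lemma mkA_eq_zero {x : PathAlg k T.t T.ℓ} : mkA T x = 0 ↔ x ∈ T.I := by
  rw [TwoSidedIdeal.mem_iff, ← map_zero (mkA T)]
  exact RingCon.eq _

variable {M N : Type*} [AddCommGroup M] [Module k M] [Module (Alg T)ᵐᵒᵖ M]
  [IsScalarTower k (Alg T)ᵐᵒᵖ M] [AddCommGroup N] [Module k N] [Module (Alg T)ᵐᵒᵖ N]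
  [IsScalarTower k (Alg T)ᵐᵒᵖ N]

/-- The right action of an element of the path algebra on a right `A`-module. -/
def act (x : PathAlg k T.t T.ℓ) : M →ₗ[k] M := Algebra.lsmul k k M (op (mkA T x))

/-- The action of the trivial path `e_v`. -/
def ev (v : Vtx T.t T.ℓ) : M →ₗ[k] M := act T (eV v)

/-- The action of the `a`-th arrow of branch `i`. -/
def ar (i : Fin T.t) (a : ℕ) : M →ₗ[k] M := act T (arE i a)

/-- The action of the path from the `a`-th to the `b`-th vertex of branch `i`. -/
def pth (i : Fin T.t) (a b : ℕ) : M →ₗ[k] M := act T (subE i a b)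

/-- The `a`-th vertex of branch `i` of the quiver of `T`. -/
abbrev vx (i : Fin T.t) (a : ℕ) : Vtx T.t T.ℓ := vtx T.t T.ℓ i a

lemma act_apply (x : PathAlg k T.t T.ℓ) (m : M) : act T x m = op (mkA T x) • m := rfl

lemma act_mul (x y : PathAlg k T.t T.ℓ) (m : M) : act T (x * y) m = act T y (act T x m) := by
  simp only [act_apply, map_mul, op_mul, mul_smul]

lemma act_one (m : M) : act T 1 m = m := by
  simp only [act_apply, map_one, op_one, one_smul]

lemma act_zero (m : M) : act T 0 m = 0 := by
  simp only [act_apply, map_zero, op_zero, zero_smul]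

lemma act_add (x y : PathAlg k T.t T.ℓ) (m : M) : act T (x + y) m = act T x m + act T y m := by
  simp only [act_apply, map_add, op_add, add_smul]

lemma act_smul (c : k) (x : PathAlg k T.t T.ℓ) (m : M) : act T (c • x) m = c • act T x m := by
  simp only [act_apply, mkA_smul, op_smul, smul_assoc]

lemma act_sum {ι : Type*} (s : Finset ι) (x : ι → PathAlg k T.t T.ℓ) (m : M) :
    act T (∑ i ∈ s, x i) m = ∑ i ∈ s, act T (x i) m := by
  simp only [act_apply, map_sum, Finset.op_sum, Finset.sum_smul]

/-- The algebra `A` is generated by the trivial paths and the arrows. -/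
lemma act_induction (p : PathAlg k T.t T.ℓ → Prop) (hv : ∀ v, p (eV v)) (ha : ∀ i j, p (arE i j))
    (hc : ∀ c : k, p (c • 1)) (hadd : ∀ x y, p x → p y → p (x + y))
    (hmul : ∀ x y, p x → p y → p (x * y)) (x : PathAlg k T.t T.ℓ) : p x := by
  obtain ⟨x, hx⟩ := x
  refine Algebra.adjoin_induction (p := fun x hx => p ⟨x, hx⟩) ?_ ?_ ?_ ?_ hx
  · rintro x (⟨v, rfl⟩ | ⟨i, j, rfl⟩)
    · exact hv v
    · exact ha i j
  · intro c
    have := hc c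
    rwa [← Algebra.algebraMap_eq_smul_one] at this
  · exact fun x y hx hy h1 h2 => hadd _ _ h1 h2
  · exact fun x y hx hy h1 h2 => hmul _ _ h1 h2

/-- A `k`-linear map commuting with the trivial paths and the arrows is `A`-linear. -/
lemma exists_linear (f : M →ₗ[k] N) (hv : ∀ v m, f (ev T v m) = ev T v (f m))
    (ha : ∀ i j m, f (ar T i j m) = ar T i j (f m)) :
    ∃ g : M →ₗ[(Alg T)ᵐᵒᵖ] N, ∀ m, g m = f m := by
  have key : ∀ x m, f (act T x m) = act T x (f m) := by
    refine act_induction T _ hv ha ?_ ?_ ?_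
    · intro c m
      simp only [act_smul, act_one, map_smul]
    · intro x y hx hy m
      simp only [act_add, map_add, hx, hy]
    · intro x y hx hy m
      simp only [act_mul, hx, hy]
  refine ⟨{ toFun := f, map_add' := map_add f, map_smul' := fun r m => ?_ }, fun _ => rfl⟩
  obtain ⟨y, hy⟩ := mkA_surjective T r.unop
  have : r = op (mkA T y) := by rw [hy, op_unop]
  subst this
  exact key y m

/-- A `k`-subspace stable under the trivial paths and the arrows is an `A`-submodule. -/
lemma exists_submodule (S : Submodule k M) (hv : ∀ v, ∀ m ∈ S, ev T v m ∈ S)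
    (ha : ∀ i j, ∀ m ∈ S, ar T i j m ∈ S) :
    ∃ S' : Submodule (Alg T)ᵐᵒᵖ M, ∀ m, m ∈ S' ↔ m ∈ S := by
  have key : ∀ x, ∀ m ∈ S, act T x m ∈ S := by
    refine act_induction T _ hv ha ?_ ?_ ?_
    · intro c m hm
      simpa only [act_smul, act_one] using S.smul_mem c hm
    · intro x y hx hy m hm
      simpa only [act_add] using S.add_mem (hx m hm) (hy m hm)
    · intro x y hx hy m hm
      simpa only [act_mul] using hy _ (hx m hm)
  refine ⟨{ S.toAddSubmonoid with smul_mem' := fun r m hm => ?_ }, fun _ => Iff.rfl⟩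
  obtain ⟨y, hy⟩ := mkA_surjective T r.unop
  have : r = op (mkA T y) := by rw [hy, op_unop]
  subst this
  exact key y m hm

variable {T}

lemma map_act (f : M →ₗ[(Alg T)ᵐᵒᵖ] N) (x : PathAlg k T.t T.ℓ) (m : M) :
    f (act T x m) = act T x (f m) := f.map_smul _ _

lemma map_ev (f : M →ₗ[(Alg T)ᵐᵒᵖ] N) (v : Vtx T.t T.ℓ) (m : M) :
    f (ev T v m) = ev T v (f m) := map_act f _ _

lemma map_ar (f : M →ₗ[(Alg T)ᵐᵒᵖ] N) (i : Fin T.t) (a : ℕ) (m : M) :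
    f (ar T i a m) = ar T i a (f m) := map_act f _ _

lemma map_pth (f : M →ₗ[(Alg T)ᵐᵒᵖ] N) (i : Fin T.t) (a b : ℕ) (m : M) :
    f (pth T i a b m) = pth T i a b (f m) := map_act f _ _

lemma map_scalar (f : M →ₗ[(Alg T)ᵐᵒᵖ] N) (c : k) (m : M) : f (c • m) = c • f m := by
  rw [← act_one T (c • m), map_smul, ← act_smul, map_act, act_smul, act_one]

/-- Restriction of scalars of an `A`-linear map to the base field. -/
def resk (f : M →ₗ[(Alg T)ᵐᵒᵖ] N) : M →ₗ[k] N :=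
  { toFun := f, map_add' := map_add f, map_smul' := map_scalar f }

lemma resk_apply (f : M →ₗ[(Alg T)ᵐᵒᵖ] N) (m : M) : resk f m = f m := rfl

lemma act_mem (S : Submodule (Alg T)ᵐᵒᵖ M) (x : PathAlg k T.t T.ℓ) {m : M} (hm : m ∈ S) :
    act T x m ∈ S := S.smul_mem _ hm

lemma scalar_mem (S : Submodule (Alg T)ᵐᵒᵖ M) (c : k) {m : M} (hm : m ∈ S) : c • m ∈ S := by
  rw [← act_one T m, ← act_smul]
  exact act_mem S _ hm

variable (T)

lemma ev_ev (v v' : Vtx T.t T.ℓ) (m : M) :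
    ev T v (ev T v' m) = if v = v' then ev T v m else 0 := by
  have h : (eV v' : PathAlg k T.t T.ℓ) * eV v = if v = v' then eV v else 0 := by
    apply Subtype.ext
    have := Ev_mul_Ev k v' v
    by_cases hv : v = v'
    · subst hv
      simpa [eV] using this
    · rw [if_neg (Ne.symm hv)] at this
      simpa [eV, hv] using this
  rw [ev, ev, ← act_mul, h]
  split_ifs
  · rfl
  · exact act_zero T m

lemma ev_self (v : Vtx T.t T.ℓ) (m : M) : ev T v (ev T v m) = ev T v m := by
  rw [ev_ev, if_pos rfl]

lemma ev_of_ne {v v' : Vtx T.t T.ℓ} (h : v ≠ v') (m : M) : ev T v (ev T v' m) = 0 := by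
  rw [ev_ev, if_neg h]

lemma sum_ev (m : M) : ∑ v, ev T v m = m := by
  have h : ∑ v, (eV v : PathAlg k T.t T.ℓ) = 1 := by
    apply Subtype.ext
    rw [AddSubmonoidClass.coe_finsetSum]
    exact sum_Ev k
  simp only [ev]
  rw [← act_sum, h, act_one]

lemma ar_ev (i : Fin T.t) (a : ℕ) (m : M) : ar T i a (ev T (vx T i a) m) = ar T i a m := by
  rw [ar, ev, ← act_mul]
  congr 2
  exact Subtype.ext (Ev_mul_Ar k i a)

lemma ev_ar (i : Fin T.t) (a : ℕ) (m : M) : ev T (vx T i (a + 1)) (ar T i a m) = ar T i a m := by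
  rw [ar, ev, ← act_mul]
  congr 2
  exact Subtype.ext (Ar_mul_Ev k i a)

lemma ar_eq_zero {i : Fin T.t} {a : ℕ} (h : T.ℓ i ≤ a) (m : M) : ar T i a m = 0 := by
  have : (arE i a : PathAlg k T.t T.ℓ) = 0 := Subtype.ext (Ar_eq_zero k i h)
  rw [ar, this, act_zero]

lemma pth_self (i : Fin T.t) (a : ℕ) (m : M) : pth T i a a m = m := by
  simp [pth, subE, act_one]

lemma pth_succ (i : Fin T.t) {a b : ℕ} (h : a ≤ b) (m : M) :
    pth T i a (b + 1) m = ar T i b (pth T i a b m) := by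
  rw [pth, pth, ar, ← act_mul]
  congr 2
  rw [subE, subE, Nat.succ_sub h, List.range_succ]
  simp [Nat.add_sub_cancel' h]

lemma pth_trans (i : Fin T.t) {a b c : ℕ} (h : a ≤ b) (h' : b ≤ c) (m : M) :
    pth T i b c (pth T i a b m) = pth T i a c m := by
  induction c, h' using Nat.le_induction with
  | base => rw [pth_self]
  | succ c hc ih => rw [pth_succ T i hc, pth_succ T i (h.trans hc), ih]

lemma pth_one (i : Fin T.t) (a : ℕ) (m : M) : pth T i a (a + 1) m = ar T i a m := by
  rw [pth_succ T i le_rfl, pth_self]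

lemma pth_ar (i : Fin T.t) {a b : ℕ} (h : a < b) (m : M) :
    pth T i (a + 1) b (ar T i a m) = pth T i a b m := by
  rw [← pth_one, pth_trans T i (by omega) h]

lemma pth_ev (i : Fin T.t) {a b : ℕ} (h : a < b) (m : M) :
    pth T i a b (ev T (vx T i a) m) = pth T i a b m := by
  rw [← pth_ar T i h, ar_ev, pth_ar T i h]

lemma ev_pth (i : Fin T.t) {a b : ℕ} (h : a < b) (m : M) :
    ev T (vx T i b) (pth T i a b m) = pth T i a b m := by
  obtain ⟨b, rfl⟩ : ∃ c, b = c + 1 := ⟨b - 1, by omega⟩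
  rw [pth_succ T i (by omega), ev_ar]

/-- A predicate holds for all vertices if it holds for all positions on the branches. -/
lemma vtx_forall (p : Vtx T.t T.ℓ → Prop) (h : ∀ i a, a ≤ T.ℓ i → p (vx T i a)) (v) : p v := by
  have i : Fin T.t := ⟨0, by have := T.ht; omega⟩
  rcases v with _ | _ | ⟨i, a⟩
  · exact h i 0 (Nat.zero_le _)
  · have := h i _ le_rfl
    rwa [vx, vtx_snk i (T.hℓ i)] at this
  · rw [vtx_mid_eq]
    exact h i _ (by omega)

lemma eq_zero_of_ev {m : M} (h : ∀ i a, a ≤ T.ℓ i → ev T (vx T i a) m = 0) : m = 0 := by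
  rw [← sum_ev T m]
  exact Finset.sum_eq_zero fun v _ => vtx_forall T (fun v => ev T v m = 0) h v

lemma mem_of_ev (S : Submodule (Alg T)ᵐᵒᵖ M) {m : M}
    (h : ∀ i a, a ≤ T.ℓ i → ev T (vx T i a) m ∈ S) : m ∈ S := by
  rw [← sum_ev T m]
  exact Submodule.sum_mem _ fun v _ => vtx_forall T (fun v => ev T v m ∈ S) h v

variable {T}

lemma hom_ext {f g : M →ₗ[(Alg T)ᵐᵒᵖ] N}
    (h : ∀ i a, a ≤ T.ℓ i → ∀ m, f (ev T (vx T i a) m) = g (ev T (vx T i a) m)) : f = g := by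
  ext m
  rw [← sub_eq_zero]
  refine eq_zero_of_ev T fun i a ha => ?_
  rw [map_sub, ← map_ev, ← map_ev, h i a ha, sub_self]

/-- Gluing of linear maps given along the branches to an `A`-linear map. -/
lemma exists_glue (h : Fin T.t → ℕ → (M →ₗ[k] N))
    (hsrc : ∀ i j m, ev T .src (h i 0 (ev T .src m)) = ev T .src (h j 0 (ev T .src m)))
    (hsnk : ∀ i j m, ev T .snk (h i (T.ℓ i) (ev T .snk m)) = ev T .snk (h j (T.ℓ j) (ev T .snk m)))
    (hcomm : ∀ i a, a < T.ℓ i → ∀ m,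
      ev T (vx T i (a + 1)) (h i (a + 1) (ar T i a m)) = ar T i a (h i a (ev T (vx T i a) m))) :
    ∃ f : M →ₗ[(Alg T)ᵐᵒᵖ] N, ∀ i a, a ≤ T.ℓ i → ∀ m,
      f (ev T (vx T i a) m) = ev T (vx T i a) (h i a (ev T (vx T i a) m)) := by
  have i₁ : Fin T.t := ⟨0, by have := T.ht; omega⟩
  let φ : Vtx T.t T.ℓ → (M →ₗ[k] N) := fun v => match v with
    | .src => h i₁ 0
    | .snk => h i₁ (T.ℓ i₁)
    | .mid i a => h i (a + 1)
  have hφ : ∀ i a, a ≤ T.ℓ i → ∀ m, ev T (vx T i a) (φ (vx T i a) (ev T (vx T i a) m)) =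
      ev T (vx T i a) (h i a (ev T (vx T i a) m)) := by
    intro i a ha m
    rcases Nat.eq_zero_or_pos a with rfl | h0
    · exact hsrc i₁ i m
    rcases ha.lt_or_eq with ha | rfl
    · rw [vx, vtx_mid i h0 ha]
      simp only [φ]
      rw [Nat.sub_add_cancel h0]
    · rw [vx, vtx_snk i (T.hℓ i)]
      exact hsnk i₁ i m
  let F : M →ₗ[k] N := ∑ v, ev T v ∘ₗ φ v ∘ₗ ev T v
  have hF : ∀ v m, F (ev T v m) = ev T v (φ v (ev T v m)) := by
    intro v m
    simp only [F, LinearMap.sum_apply, LinearMap.comp_apply]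
    rw [Finset.sum_eq_single v]
    · rw [ev_self]
    · intro v' _ hv'
      rw [ev_of_ne T hv', map_zero, map_zero]
    · simp
  have hF' : ∀ v m, ev T v (F m) = ev T v (φ v (ev T v m)) := by
    intro v m
    simp only [F, LinearMap.sum_apply, LinearMap.comp_apply, map_sum]
    rw [Finset.sum_eq_single v]
    · rw [ev_self]
    · intro v' _ hv'
      rw [ev_of_ne T hv'.symm]
    · simp
  obtain ⟨f, hf⟩ := exists_linear T F (fun v m => by rw [hF, hF']) (fun i a m => by
    rcases lt_or_ge a (T.ℓ i) with ha | ha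
    · rw [← ev_ar, hF, hφ i (a + 1) ha, ev_ar, hcomm i a ha, ← ar_ev T i a (F m), hF', hφ i a ha.le,
        ar_ev]
    · rw [ar_eq_zero T ha, ar_eq_zero T ha, map_zero])
  exact ⟨f, fun i a ha m => by rw [hf, hF, hφ i a ha]⟩

end Action

end Toupie

namespace Toupie

section Dimension

variable {k : Type u} [Field k] (T : ToupieAlg k)

/-- The module vanishes at the source, and all arrows act injectively. -/
def ArrowInj (M : Type*) [AddCommGroup M] [Module k M] [Module (Alg T)ᵐᵒᵖ M]
    [IsScalarTower k (Alg T)ᵐᵒᵖ M] : Prop :=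
  (∀ m : M, ev T .src m = 0) ∧
    ∀ i a, a < T.ℓ i → ∀ m : M, ar T i a m = 0 → ev T (vx T i a) m = 0

/-- The module vanishes at the sink, and all arrows act surjectively. -/
def ArrowSurj (M : Type*) [AddCommGroup M] [Module k M] [Module (Alg T)ᵐᵒᵖ M]
    [IsScalarTower k (Alg T)ᵐᵒᵖ M] : Prop :=
  (∀ m : M, ev T .snk m = 0) ∧
    ∀ i a, a < T.ℓ i → ∀ m : M, ∃ m', ar T i a m' = ev T (vx T i (a + 1)) m

variable {T}
variable {M N P X Y E : Type*} [AddCommGroup M] [Module k M] [Module (Alg T)ᵐᵒᵖ M]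
  [IsScalarTower k (Alg T)ᵐᵒᵖ M] [AddCommGroup N] [Module k N] [Module (Alg T)ᵐᵒᵖ N]
  [IsScalarTower k (Alg T)ᵐᵒᵖ N] [AddCommGroup P] [Module k P] [Module (Alg T)ᵐᵒᵖ P]
  [IsScalarTower k (Alg T)ᵐᵒᵖ P] [AddCommGroup X] [Module k X] [Module (Alg T)ᵐᵒᵖ X]
  [IsScalarTower k (Alg T)ᵐᵒᵖ X] [AddCommGroup Y] [Module k Y] [Module (Alg T)ᵐᵒᵖ Y]
  [IsScalarTower k (Alg T)ᵐᵒᵖ Y] [AddCommGroup E] [Module k E] [Module (Alg T)ᵐᵒᵖ E]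
  [IsScalarTower k (Alg T)ᵐᵒᵖ E]

/-- Lifting along a surjection, along one branch with injective arrows. -/
lemma exists_branch_lift (hP : ArrowInj T P) (g : P →ₗ[(Alg T)ᵐᵒᵖ] N) (π : M →ₗ[(Alg T)ᵐᵒᵖ] N)
    (hπ : Function.Surjective π) (i : Fin T.t) :
    ∃ h : ℕ → (P →ₗ[k] M), (∀ a ≤ T.ℓ i, ∀ x, π (h a x) = g x) ∧
      ∀ a < T.ℓ i, ∀ x, h (a + 1) (ar T i a x) = ar T i a (h a (ev T (vx T i a) x)) := by
  refine exists_seq_up (T.ℓ i)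
    (fun a (h h' : P →ₗ[k] M) => ∀ x, h' (ar T i a x) = ar T i a (h (ev T (vx T i a) x)))
    (fun _ (h : P →ₗ[k] M) => ∀ x, π (h x) = g x) ?_ ?_
  · obtain ⟨h, -, h2⟩ := exists_extend_lift (0 : (Unit → k) →ₗ[k] P) 0 (resk g) (resk π) hπ
      (fun x => by simp) (fun x _ => rfl)
    exact ⟨h, h2⟩
  · intro a ha h hh
    obtain ⟨h', h1, h2⟩ := exists_extend_lift (ar T i a : P →ₗ[k] P)
      (ar T i a ∘ₗ h ∘ₗ ev T (vx T i a)) (resk g) (resk π) hπ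
      (fun x => by
        simp only [LinearMap.comp_apply, resk_apply]
        rw [map_ar, hh, map_ev, ar_ev, map_ar])
      (fun x hx => by simp [hP.2 i a ha x hx])
    exact ⟨h', h2, h1⟩

/-- Extension along an injection, along one branch with surjective arrows. -/
lemma exists_branch_extend (hE : ArrowSurj T E) (ι : X →ₗ[(Alg T)ᵐᵒᵖ] Y)
    (hι : Function.Injective ι) (g : X →ₗ[(Alg T)ᵐᵒᵖ] E) (i : Fin T.t) :
    ∃ h : ℕ → (Y →ₗ[k] E), (∀ a ≤ T.ℓ i, ∀ x, h a (ι x) = g x) ∧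
      ∀ a < T.ℓ i, ∀ y, ar T i a (h a y) = ev T (vx T i (a + 1)) (h (a + 1) (ar T i a y)) := by
  refine exists_seq_down (T.ℓ i)
    (fun a (h h' : Y →ₗ[k] E) => ∀ y, ar T i a (h y) = ev T (vx T i (a + 1)) (h' (ar T i a y)))
    (fun _ (h : Y →ₗ[k] E) => ∀ x, h (ι x) = g x) ?_ ?_
  · obtain ⟨h, h1, -⟩ := exists_lift_extend (resk ι) (resk g) (0 : E →ₗ[k] E) 0 hι
      (fun x => by simp) (fun y => ⟨0, by simp⟩)
    exact ⟨h, h1⟩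
  · intro a ha h hh
    obtain ⟨h', h1, h2⟩ := exists_lift_extend (resk ι) (resk g) (ar T i a : E →ₗ[k] E)
      (ev T (vx T i (a + 1)) ∘ₗ h ∘ₗ ar T i a) hι
      (fun x => by
        simp only [LinearMap.comp_apply, resk_apply]
        rw [← map_ar, hh, map_ar, ev_ar])
      (fun y => hE.2 i a ha _)
    exact ⟨h', h1, h2⟩

/-- The submodule of elements supported on a successor-closed set of vertices. -/
lemma exists_suppSub (M : Type*) [AddCommGroup M] [Module k M] [Module (Alg T)ᵐᵒᵖ M]
    [IsScalarTower k (Alg T)ᵐᵒᵖ M] (W : Set (Vtx T.t T.ℓ))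
    (hW : ∀ i a, a < T.ℓ i → vx T i a ∈ W → vx T i (a + 1) ∈ W) :
    ∃ S : Submodule (Alg T)ᵐᵒᵖ M, ∀ m, m ∈ S ↔ ∀ v ∉ W, ev T v m = 0 := by
  let S : Submodule k M := ⨅ v ∈ Wᶜ, LinearMap.ker (ev T v : M →ₗ[k] M)
  have hS : ∀ m, m ∈ S ↔ ∀ v ∉ W, ev T v m = 0 := by simp [S, Submodule.mem_iInf]
  obtain ⟨S', hS'⟩ := exists_submodule T S (by
      intro v m hm
      rw [hS] at hm ⊢
      intro v' hv'
      rw [ev_ev]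
      split_ifs
      · exact hm v' hv'
      · rfl) (by
      intro i a m hm
      rw [hS] at hm ⊢
      intro v hv
      rcases lt_or_ge a (T.ℓ i) with ha | ha
      · rw [← ev_ar, ev_ev]
        split_ifs with h
        · subst h
          rw [← ar_ev, hm _ (fun h => hv (hW i a ha h)), map_zero, map_zero]
        · rfl
      · rw [ar_eq_zero T ha, map_zero])
  exact ⟨S', fun m => (hS' m).trans (hS m)⟩

/-- The interior vertices of a branch. -/
def inner (i : Fin T.t) : Set (Vtx T.t T.ℓ) := {v | ∃ a, 0 < a ∧ a < T.ℓ i ∧ v = vx T i a}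

lemma vx_mem_inner {i : Fin T.t} {a : ℕ} (h0 : 0 < a) (ha : a < T.ℓ i) :
    vx T i a ∈ inner i := ⟨a, h0, ha, rfl⟩

lemma vx_mem_inner_iff {i j : Fin T.t} {a : ℕ} (ha : a ≤ T.ℓ i) :
    vx T i a ∈ inner j ↔ i = j ∧ 0 < a ∧ a < T.ℓ i := by
  constructor
  · rintro ⟨b, h0, hb, h⟩
    obtain ⟨rfl, rfl⟩ := vtx_inj h0 hb ha (T.hℓ i) h.symm
    exact ⟨rfl, h0, hb⟩
  · rintro ⟨rfl, h0, ha⟩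
    exact ⟨a, h0, ha, rfl⟩

lemma projective_of_arrowInj {P : Type u} [AddCommGroup P] [Module k P] [Module (Alg T)ᵐᵒᵖ P]
    [IsScalarTower k (Alg T)ᵐᵒᵖ P] (hP : ArrowInj T P) (i : Fin T.t)
    (hs : ∀ v, v ≠ .snk → v ∉ inner i → ∀ m : P, ev T v m = 0) :
    Module.Projective (Alg T)ᵐᵒᵖ P := by
  refine Module.Projective.of_lifting_property'' fun π hπ => ?_
  obtain ⟨h, h1, h2⟩ := exists_branch_lift hP (LinearMap.id : P →ₗ[(Alg T)ᵐᵒᵖ] P) π hπ i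
  have hz : ∀ j a, j ≠ i → a < T.ℓ j → ∀ m : P, ev T (vx T j a) m = 0 := fun j a hj ha m =>
    hs _ (vtx_ne_snk j ha) (fun h => hj ((vx_mem_inner_iff ha.le).1 h).1) m
  obtain ⟨f, hf⟩ := exists_glue (fun j a => if a = T.ℓ j then h (T.ℓ i) else h a)
    (fun j j' m => by simp [hP.1]) (fun j j' m => by simp) (fun j a ha m => by
      by_cases hj : j = i
      · subst hj
        have := h2 a ha m
        rw [if_neg ha.ne]
        split_ifs with h
        · rw [← h, this, ev_ar]
        · rw [this, ev_ar]
      · rw [← ar_ev, hz j a hj ha]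
        simp)
  refine ⟨f, hom_ext fun j a ha m => ?_⟩
  rw [LinearMap.comp_apply, hf j a ha, map_ev]
  rcases ha.lt_or_eq with ha | rfl
  · by_cases hj : j = i
    · subst hj
      rw [if_neg ha.ne, h1 a ha.le]
      simp [ev_self]
    · rw [hz j a hj ha]
      simp [hz j a hj ha]
  · rw [if_pos rfl, h1 _ le_rfl]
    simp [ev_self]

lemma injective_of_arrowSurj {E : Type u} [AddCommGroup E] [Module k E] [Module (Alg T)ᵐᵒᵖ E]
    [IsScalarTower k (Alg T)ᵐᵒᵖ E] (hE : ArrowSurj T E) (i : Fin T.t)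
    (hs : ∀ v, v ≠ .src → v ∉ inner i → ∀ m : E, ev T v m = 0) :
    Module.Injective (Alg T)ᵐᵒᵖ E := by
  refine ⟨fun X Y _ _ _ _ ι hι g => ?_⟩
  let _ : Module k X := Module.restrictScalars k (Alg T)ᵐᵒᵖ X
  have _ : IsScalarTower k (Alg T)ᵐᵒᵖ X := IsScalarTower.restrictScalars k _ X
  let _ : Module k Y := Module.restrictScalars k (Alg T)ᵐᵒᵖ Y
  have _ : IsScalarTower k (Alg T)ᵐᵒᵖ Y := IsScalarTower.restrictScalars k _ Y
  obtain ⟨h, h1, h2⟩ := exists_branch_extend hE ι hι g i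
  have hz : ∀ j a, j ≠ i → 0 < a → a ≤ T.ℓ j → ∀ m : E, ev T (vx T j a) m = 0 :=
    fun j a hj h0 ha m => hs _ (vtx_ne_src j h0) (fun h => hj ((vx_mem_inner_iff ha).1 h).1) m
  obtain ⟨f, hf⟩ := exists_glue (fun j a => if a = 0 then h 0 else h a)
    (fun j j' m => by simp) (fun j j' m => (hE.1 _).trans (hE.1 _).symm) (fun j a ha m => by
      by_cases hj : j = i
      · subst hj
        have := h2 a ha (ev T (vx T j a) m)
        rw [ar_ev] at this
        rw [if_neg (by omega), ← this]
        split_ifs with h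
        · rw [h]
        · rfl
      · rw [hz j (a + 1) hj (by omega) (by omega), ← ev_ar T j a,
          hz j (a + 1) hj (by omega) (by omega)])
  refine ⟨f, fun x => ?_⟩
  suffices f ∘ₗ ι = g from LinearMap.congr_fun this x
  refine hom_ext fun j a ha m => ?_
  rw [LinearMap.comp_apply, map_ev, hf j a ha, ← map_ev]
  rcases Nat.eq_zero_or_pos a with rfl | h0
  · rw [if_pos rfl, h1 0 (Nat.zero_le _), map_ev, ev_self]
  · by_cases hj : j = i
    · subst hj
      rw [if_neg h0.ne', h1 a ha, map_ev, ev_self]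
    · rw [map_ev g, hz j a hj h0 ha, hz j a hj h0 ha]

end Dimension

end Toupie

namespace Toupie

section HomologicalDimension

variable {k : Type u} [Field k] {T : ToupieAlg k}
variable {M N : Type*} [AddCommGroup M] [Module k M] [Module (Alg T)ᵐᵒᵖ M]
  [IsScalarTower k (Alg T)ᵐᵒᵖ M] [AddCommGroup N] [Module k N] [Module (Alg T)ᵐᵒᵖ N]
  [IsScalarTower k (Alg T)ᵐᵒᵖ N]

lemma ArrowInj.of_injective (hN : ArrowInj T N) (f : M →ₗ[(Alg T)ᵐᵒᵖ] N)
    (hf : Function.Injective f) : ArrowInj T M := by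
  refine ⟨fun m => hf ?_, fun i a ha m hm => hf ?_⟩
  · rw [map_ev, hN.1, map_zero]
  · rw [map_ev, map_zero]
    exact hN.2 i a ha _ (by rw [← map_ar, hm, map_zero])

lemma ArrowSurj.of_surjective (hM : ArrowSurj T M) (f : M →ₗ[(Alg T)ᵐᵒᵖ] N)
    (hf : Function.Surjective f) : ArrowSurj T N := by
  refine ⟨fun n => ?_, fun i a ha n => ?_⟩
  · obtain ⟨m, rfl⟩ := hf n
    rw [← map_ev, hM.1, map_zero]
  · obtain ⟨m, rfl⟩ := hf n
    obtain ⟨m', hm'⟩ := hM.2 i a ha m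
    exact ⟨f m', by rw [← map_ar, hm', map_ev]⟩

variable {ι : Type*} {L : ι → Type*} [∀ j, AddCommGroup (L j)] [∀ j, Module k (L j)]
  [∀ j, Module (Alg T)ᵐᵒᵖ (L j)] [∀ j, IsScalarTower k (Alg T)ᵐᵒᵖ (L j)]

lemma ev_pi (v : Vtx T.t T.ℓ) (x : ∀ j, L j) (j : ι) : ev T v x j = ev T v (x j) :=
  map_ev (LinearMap.proj j : (∀ j, L j) →ₗ[(Alg T)ᵐᵒᵖ] L j) v x

lemma ar_pi (i : Fin T.t) (a : ℕ) (x : ∀ j, L j) (j : ι) : ar T i a x j = ar T i a (x j) :=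
  map_ar (LinearMap.proj j : (∀ j, L j) →ₗ[(Alg T)ᵐᵒᵖ] L j) i a x

lemma ArrowInj.pi (h : ∀ j, ArrowInj T (L j)) : ArrowInj T (∀ j, L j) := by
  refine ⟨fun m => funext fun j => ?_, fun i a ha m hm => funext fun j => ?_⟩
  · rw [ev_pi, (h j).1, Pi.zero_apply]
  · rw [ev_pi, Pi.zero_apply, (h j).2 i a ha _ (by rw [← ar_pi, hm, Pi.zero_apply])]

lemma ArrowSurj.pi (h : ∀ j, ArrowSurj T (L j)) : ArrowSurj T (∀ j, L j) := by
  refine ⟨fun m => funext fun j => ?_, fun i a ha m => ?_⟩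
  · rw [ev_pi, (h j).1, Pi.zero_apply]
  · choose m' hm' using fun j => (h j).2 i a ha (m j)
    exact ⟨m', funext fun j => by rw [ar_pi, hm', ev_pi]⟩

lemma pdLeOne_of_arrowInj (M : ModuleCat.{u} (Alg T)ᵐᵒᵖ) [Module k M]
    [IsScalarTower k (Alg T)ᵐᵒᵖ M] (hM : ArrowInj T M) : PdLeOne (Alg T)ᵐᵒᵖ M := by
  have i₁ : Fin T.t := ⟨0, by have := T.ht; omega⟩
  choose S hS using fun j : Fin T.t => exists_suppSub (T := T) M (inner j ∪ {.snk}) (by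
    rintro i a ha (h | h)
    · obtain ⟨rfl, h0, -⟩ := (vx_mem_inner_iff ha.le).1 h
      rcases (Nat.succ_le_of_lt ha).lt_or_eq with h | h
      · exact Or.inl (vx_mem_inner (by omega) h)
      · refine Or.inr ?_
        rw [Set.mem_singleton_iff, ← vtx_snk i (T.hℓ i), ← h]
    · exact absurd h (vtx_ne_snk i ha))
  have hinj : ∀ j, ArrowInj T (S j) := fun j => hM.of_injective _ (S j).injective_subtype
  have hproj : ∀ j, Module.Projective (Alg T)ᵐᵒᵖ (S j) := fun j =>
    projective_of_arrowInj (hinj j) j fun v h1 h2 m => Subtype.ext <| by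
      rw [← Submodule.subtype_apply, map_ev]
      exact (hS j _).1 m.2 v (by simp [h1, h2])
  let f : (∀ j, S j) →ₗ[(Alg T)ᵐᵒᵖ] M := ∑ j, (S j).subtype ∘ₗ LinearMap.proj j
  have hf : ∀ x, f x = ∑ j, (x j : M) := fun x => by simp [f]
  refine ⟨ModuleCat.of _ (∀ j, S j), f, ?_, ?_, ?_⟩
  · rw [← LinearMap.range_eq_top, eq_top_iff]
    intro m _
    refine mem_of_ev T _ fun i a ha => ?_
    have hmem : ev T (vx T i a) m ∈ S i := by
      rw [hS]
      intro v hv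
      by_cases h : v = vx T i a
      · subst h
        rcases Nat.eq_zero_or_pos a with rfl | h0
        · exact hM.1 _
        · rcases ha.lt_or_eq with ha | rfl
          · exact absurd (Or.inl (vx_mem_inner h0 ha)) hv
          · exact absurd (Or.inr (vtx_snk i (T.hℓ i))) hv
      · exact ev_of_ne T h m
    refine ⟨Pi.single i ⟨_, hmem⟩, ?_⟩
    rw [hf, Finset.sum_eq_single i]
    · simp
    · intro j _ hj
      simp [Pi.single_eq_of_ne hj]
    · simp
  · exact Module.Projective.of_equiv (DFinsupp.linearEquivFunOnFintype (R := (Alg T)ᵐᵒᵖ)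
      (M := fun j => S j))
  · refine projective_of_arrowInj ((ArrowInj.pi hinj).of_injective _
      (LinearMap.ker f).injective_subtype) i₁ fun v h1 _ m => Subtype.ext ?_
    rw [← Submodule.subtype_apply, map_ev]
    obtain ⟨x, hx⟩ := m
    rw [LinearMap.mem_ker, hf] at hx
    rw [Submodule.subtype_apply]
    ext j
    rw [ev_pi]
    revert h1
    refine vtx_forall T (fun v => v ≠ .snk → (↑(ev T v (x j)) : M) = _) ?_ v
    intro i a ha h1
    rw [← Submodule.subtype_apply, map_ev]
    rcases Nat.eq_zero_or_pos a with rfl | h0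
    · exact hM.1 _
    rcases ha.lt_or_eq with ha | rfl
    · have key : ∀ j, j ≠ i → ev T (vx T i a) (x j : M) = 0 := fun j hj =>
        (hS j _).1 (x j).2 _ (by
          rintro (h | h)
          · exact hj ((vx_mem_inner_iff ha.le).1 h).1.symm
          · exact vtx_ne_snk i ha h)
      by_cases hj : j = i
      · subst hj
        have := congrArg (ev T (vx T j a)) hx
        rwa [map_sum, map_zero, Finset.sum_eq_single j (fun j' _ h => key j' h) (by simp)] at this
      · exact key j hj
    · exact absurd (vtx_snk i (T.hℓ i)) h1

lemma idLeOne_of_arrowSurj (M : ModuleCat.{u} (Alg T)ᵐᵒᵖ) [Module k M]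
    [IsScalarTower k (Alg T)ᵐᵒᵖ M] (hM : ArrowSurj T M) : IdLeOne (Alg T)ᵐᵒᵖ M := by
  have i₁ : Fin T.t := ⟨0, by have := T.ht; omega⟩
  choose S hS using fun j : Fin T.t => exists_suppSub (T := T) M (inner j ∪ {.src})ᶜ (by
    rintro i a ha h (h' | h')
    · obtain ⟨rfl, -, h1⟩ := (vx_mem_inner_iff ha).1 h'
      rcases Nat.eq_zero_or_pos a with rfl | h0
      · exact h (Or.inr (vtx_zero _))
      · exact h (Or.inl (vx_mem_inner h0 ha))
    · exact vtx_ne_src i (Nat.succ_pos a) h')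
  have hsurj : ∀ j, ArrowSurj T (M ⧸ S j) := fun j => hM.of_surjective _ (S j).mkQ_surjective
  have hev : ∀ j v, v ≠ .src → v ∉ inner j → ∀ m : M, ev T v m ∈ S j := by
    intro j v h1 h2 m
    rw [hS]
    intro v' hv'
    refine ev_of_ne T ?_ m
    rintro rfl
    exact hv' (by simp [h1, h2])
  have hsupp : ∀ j v, v ≠ .src → v ∉ inner j → ∀ m : M ⧸ S j, ev T v m = 0 := by
    intro j v h1 h2 m
    obtain ⟨m, rfl⟩ := (S j).mkQ_surjective m
    rw [← map_ev, Submodule.mkQ_apply, Submodule.Quotient.mk_eq_zero]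
    exact hev j v h1 h2 m
  have hinj : ∀ j, Module.Injective (Alg T)ᵐᵒᵖ (M ⧸ S j) := fun j =>
    injective_of_arrowSurj (hsurj j) j (hsupp j)
  let f : M →ₗ[(Alg T)ᵐᵒᵖ] (∀ j, M ⧸ S j) := LinearMap.pi fun j => (S j).mkQ
  refine ⟨ModuleCat.of _ (∀ j, M ⧸ S j), f, ?_, ?_, ?_⟩
  · rw [← LinearMap.ker_eq_bot, eq_bot_iff]
    intro m hm
    have hm' : ∀ j, m ∈ S j := fun j => by
      have := congrFun (LinearMap.mem_ker.1 hm) j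
      rwa [LinearMap.pi_apply, Submodule.mkQ_apply, Pi.zero_apply,
        Submodule.Quotient.mk_eq_zero] at this
    refine eq_zero_of_ev T fun i a ha => ?_
    rcases ha.lt_or_eq with ha | rfl
    · refine (hS i _).1 (hm' i) _ (not_not.2 ?_)
      rcases Nat.eq_zero_or_pos a with rfl | h0
      · exact Or.inr (vtx_zero _)
      · exact Or.inl (vx_mem_inner h0 ha)
    · rw [vx, vtx_snk i (T.hℓ i)]
      exact hM.1 m
  · exact inferInstanceAs (Module.Injective (Alg T)ᵐᵒᵖ (∀ j, M ⧸ S j))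
  · refine injective_of_arrowSurj ((ArrowSurj.pi hsurj).of_surjective _
      (LinearMap.range f).mkQ_surjective) i₁ fun v h1 _ m => ?_
    obtain ⟨x, rfl⟩ := (LinearMap.range f).mkQ_surjective m
    rw [← map_ev, Submodule.mkQ_apply, Submodule.Quotient.mk_eq_zero]
    revert h1
    refine vtx_forall T (fun v => v ≠ .src → ev T v x ∈ _) ?_ v
    intro i a ha h1
    obtain ⟨m, hm⟩ := (S i).mkQ_surjective (x i)
    refine ⟨ev T (vx T i a) m, funext fun j => ?_⟩
    rw [ev_pi, LinearMap.pi_apply]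
    by_cases hj : j = i
    · subst hj
      rw [map_ev, hm]
    · have : vx T i a ∉ inner j := fun h => hj ((vx_mem_inner_iff ha).1 h).1.symm
      rw [hsupp j _ h1 this, Submodule.mkQ_apply, Submodule.Quotient.mk_eq_zero]
      exact hev j _ h1 this m

end HomologicalDimension

end Toupie

namespace Toupie

section Splitting

variable {k : Type u} [Field k] {T : ToupieAlg k}
variable {M : Type*} [AddCommGroup M] [Module k M] [Module (Alg T)ᵐᵒᵖ M]
  [IsScalarTower k (Alg T)ᵐᵒᵖ M]

lemma vx_eq_succ {i j : Fin T.t} {a b : ℕ} (ha : a ≤ T.ℓ i) (hb : b < T.ℓ j)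
    (h : vx T i a = vx T j (b + 1)) : (i = j ∧ a = b + 1) ∨ (a = T.ℓ i ∧ b + 1 = T.ℓ j) := by
  rcases (Nat.succ_le_of_lt hb).lt_or_eq with hb' | hb'
  · obtain ⟨rfl, rfl⟩ := vtx_inj (Nat.succ_pos b) hb' ha (T.hℓ i) h.symm
    exact Or.inl ⟨rfl, rfl⟩
  · refine Or.inr ⟨ha.eq_of_not_lt fun ha' => vtx_ne_snk i ha' ?_, hb'⟩
    rw [← vtx_snk j (T.hℓ j), ← hb']
    exact h

/-- If all branches act by zero on an indecomposable module which does not vanish at the source,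
then all arrows act surjectively. -/
lemma src_eq_zero_or_arrowSurj
    (hI : ∀ f : M →ₗ[(Alg T)ᵐᵒᵖ] M, f ∘ₗ f = f → f = 0 ∨ f = LinearMap.id)
    (hw : ∀ i (m : M), pth T i 0 (T.ℓ i) m = 0) :
    (∀ m : M, ev T .src m = 0) ∨ ArrowSurj T M := by
  let S : Submodule k M := ⨅ (i) (a) (_ : a ≤ T.ℓ i),
    (LinearMap.range (pth T i 0 a ∘ₗ ev T .src : M →ₗ[k] M)).comap (ev T (vx T i a))
  have hS : ∀ m, m ∈ S ↔ ∀ i a, a ≤ T.ℓ i → ∃ m₀, pth T i 0 a (ev T .src m₀) =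
      ev T (vx T i a) m := by
    intro m
    simp [S, Submodule.mem_iInf]
  obtain ⟨X, hX⟩ := exists_submodule T S (by
      intro v m hm
      rw [hS] at hm ⊢
      intro i a ha
      rw [ev_ev]
      split_ifs
      · exact hm i a ha
      · exact ⟨0, by simp⟩) (by
      intro j b m hm
      rw [hS] at hm ⊢
      intro i a ha
      rcases lt_or_ge b (T.ℓ j) with hb | hb
      · by_cases h : vx T i a = vx T j (b + 1)
        · obtain ⟨m₀, hm₀⟩ := hm j b hb.le
          have key : ar T j b m = pth T j 0 (b + 1) (ev T .src m₀) := by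
            rw [pth_succ T j (Nat.zero_le b), hm₀, ar_ev]
          rw [h, ev_ar, key]
          rcases vx_eq_succ ha hb h with ⟨rfl, rfl⟩ | ⟨rfl, h'⟩
          · exact ⟨m₀, rfl⟩
          · rw [h', hw]
            exact ⟨0, by simp⟩
        · rw [← ev_ar, ev_of_ne T h]
          exact ⟨0, by simp⟩
      · rw [ar_eq_zero T hb]
        exact ⟨0, by simp⟩)
  simp only [hS] at hX
  have i₁ : Fin T.t := ⟨0, by have := T.ht; omega⟩
  have hsrc : ∀ m : M, ev T .src m ∈ X := by
    intro m
    rw [hX]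
    intro i a ha
    rcases Nat.eq_zero_or_pos a with rfl | h0
    · exact ⟨m, by rw [pth_self]; exact (ev_self T _ m).symm⟩
    · exact ⟨0, by rw [ev_of_ne T (vtx_ne_src i h0)]; simp⟩
  have hXs : ArrowSurj T X := by
    refine ⟨fun m => Subtype.ext ?_, fun i a ha m => ?_⟩
    · obtain ⟨m₀, hm₀⟩ := (hX _).1 m.2 i₁ _ le_rfl
      rw [hw, vx, vtx_snk i₁ (T.hℓ i₁)] at hm₀
      rw [← Submodule.subtype_apply, map_ev, Submodule.subtype_apply, ← hm₀]
      rfl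
    · obtain ⟨m₀, hm₀⟩ := (hX _).1 m.2 i (a + 1) ha
      refine ⟨pth T i 0 a ⟨_, hsrc m₀⟩, Subtype.ext ?_⟩
      rw [← Submodule.subtype_apply, ← Submodule.subtype_apply, map_ev, map_ar, map_pth,
        Submodule.subtype_apply, Submodule.subtype_apply, ← hm₀, pth_succ T i (Nat.zero_le a)]
  choose h h1 h2 using exists_branch_extend hXs X.subtype X.injective_subtype LinearMap.id
  obtain ⟨r, hr⟩ := exists_glue h (fun i j m => by
      rw [show ev T .src m = X.subtype ⟨_, hsrc m⟩ from rfl, h1 i 0 (Nat.zero_le _),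
        h1 j 0 (Nat.zero_le _)])
    (fun i j m => (hXs.1 _).trans (hXs.1 _).symm)
    (fun i a ha m => by rw [h2 i a ha, ar_ev])
  have hrι : r ∘ₗ X.subtype = LinearMap.id := hom_ext fun i a ha m => by
    rw [LinearMap.comp_apply, map_ev, hr i a ha, ← map_ev, h1 i a ha, LinearMap.id_apply, ev_self]
  rcases hI (X.subtype ∘ₗ r) (by
    rw [LinearMap.comp_assoc, ← LinearMap.comp_assoc r, hrι, LinearMap.id_comp]) with he | he
  · left
    intro m
    have h3 := LinearMap.congr_fun hrι ⟨_, hsrc m⟩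
    have h4 := LinearMap.congr_fun he (ev T .src m)
    rw [LinearMap.comp_apply, show r (ev T .src m) = _ from h3] at h4
    exact h4
  · right
    exact hXs.of_surjective X.subtype fun m => ⟨r m, LinearMap.congr_fun he m⟩

/-- An indecomposable module vanishing at the source vanishes at the sink, unless all arrows act
injectively. -/
lemma arrowInj_or_snk_eq_zero
    (hI : ∀ f : M →ₗ[(Alg T)ᵐᵒᵖ] M, f ∘ₗ f = f → f = 0 ∨ f = LinearMap.id)
    (h0 : ∀ m : M, ev T .src m = 0) :
    ArrowInj T M ∨ ∀ m : M, ev T .snk m = 0 := by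
  let S : Submodule k M := ⨅ (i) (a) (_ : a ≤ T.ℓ i),
    LinearMap.ker (pth T i a (T.ℓ i) ∘ₗ ev T (vx T i a) : M →ₗ[k] M)
  have hS : ∀ m, m ∈ S ↔ ∀ i a, a ≤ T.ℓ i → pth T i a (T.ℓ i) (ev T (vx T i a) m) = 0 := by
    intro m
    simp [S, Submodule.mem_iInf]
  obtain ⟨K, hK⟩ := exists_submodule T S (by
      intro v m hm
      rw [hS] at hm ⊢
      intro i a ha
      rw [ev_ev]
      split_ifs
      · exact hm i a ha
      · rw [map_zero]) (by
      intro j b m hm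
      rw [hS] at hm ⊢
      intro i a ha
      rcases lt_or_ge b (T.ℓ j) with hb | hb
      · by_cases h : vx T i a = vx T j (b + 1)
        · rw [h, ev_ar]
          have := hm j b hb.le
          rcases vx_eq_succ ha hb h with ⟨rfl, rfl⟩ | ⟨rfl, h'⟩
          · rwa [pth_ar T i hb, ← pth_ev T i hb]
          · rwa [pth_self, ← pth_one, h', ← pth_ev T j hb]
        · rw [← ev_ar, ev_of_ne T h, map_zero]
      · rw [ar_eq_zero T hb, map_zero, map_zero])
  simp only [hS] at hK
  have i₁ : Fin T.t := ⟨0, by have := T.ht; omega⟩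
  have hKs : ∀ m ∈ K, ev T .snk m = 0 := by
    intro m hm
    have := (hK m).1 hm i₁ _ le_rfl
    rwa [pth_self, vx, vtx_snk i₁ (T.hℓ i₁)] at this
  have hQs : ∀ x : M ⧸ K, ev T .src x = 0 := by
    intro x
    obtain ⟨m, rfl⟩ := K.mkQ_surjective x
    rw [← map_ev, h0, map_zero]
  have hQ : ArrowInj T (M ⧸ K) := by
    refine ⟨hQs, fun i a ha x hx => ?_⟩
    rcases Nat.eq_zero_or_pos a with rfl | ha0
    · exact hQs x
    obtain ⟨m, rfl⟩ := K.mkQ_surjective x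
    rw [← map_ar, Submodule.mkQ_apply, Submodule.Quotient.mk_eq_zero, hK] at hx
    rw [← map_ev, Submodule.mkQ_apply, Submodule.Quotient.mk_eq_zero, hK]
    intro j b hb
    by_cases h : vx T i a = vx T j b
    · obtain ⟨rfl, rfl⟩ := vtx_inj ha0 ha hb (T.hℓ j) h
      have := hx i (a + 1) ha
      rwa [ev_ar, pth_ar T i ha, ← pth_ev T i ha, ← ev_self] at this
    · rw [ev_of_ne T (Ne.symm h), map_zero]
  choose h h1 h2 using exists_branch_lift hQ LinearMap.id K.mkQ K.mkQ_surjective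
  obtain ⟨s, hs⟩ := exists_glue h (fun i j m => by rw [hQs]; simp)
    (fun i j x => by
      rw [← sub_eq_zero, ← map_sub]
      apply hKs
      rw [← Submodule.Quotient.mk_eq_zero, ← Submodule.mkQ_apply, map_sub, h1 i _ le_rfl,
        h1 j _ le_rfl, sub_self])
    (fun i a ha x => by rw [h2 i a ha, ev_ar])
  have hπs : K.mkQ ∘ₗ s = LinearMap.id := hom_ext fun i a ha x => by
    rw [LinearMap.comp_apply, hs i a ha, map_ev, h1 i a ha, LinearMap.id_apply,
      ev_self]
  rcases hI (s ∘ₗ K.mkQ) (by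
    rw [LinearMap.comp_assoc, ← LinearMap.comp_assoc K.mkQ, hπs, LinearMap.id_comp]) with he | he
  · right
    intro m
    apply hKs
    have h3 := LinearMap.congr_fun hπs (K.mkQ m)
    have h4 := LinearMap.congr_fun he m
    rw [LinearMap.comp_apply] at h3 h4
    rw [h4, LinearMap.zero_apply, map_zero, LinearMap.id_apply, Submodule.mkQ_apply] at h3
    rwa [← Submodule.Quotient.mk_eq_zero, eq_comm]
  · left
    refine hQ.of_injective K.mkQ fun x y hxy => ?_
    rw [← LinearMap.id_apply (R := (Alg T)ᵐᵒᵖ) x, ← LinearMap.id_apply (R := (Alg T)ᵐᵒᵖ) y, ← he]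
    exact congrArg s hxy

end Splitting

end Toupie

namespace Toupie

section Types

variable {k : Type u} [Field k] (T : ToupieAlg k)

/-- All branches other than `i₀` coincide in the algebra up to nonzero scalars, and the branch `i₀`
lies in the ideal. -/
structure BranchRel (i₀ i₂ : Fin T.t) (c : Fin T.t → k) : Prop where
  ne : i₂ ≠ i₀
  mem : wE i₀ ∈ T.I
  c_ne : ∀ j, j ≠ i₀ → c j ≠ 0
  eq : ∀ j, j ≠ i₀ → mkA T (wE j) = c j • mkA T (wE i₂)

/-- A pair of elements of `M` generating a copy of the representation with parameters `x`, `y`,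
together with linear forms splitting it off. -/
structure SplitPair (i₀ i₂ : Fin T.t) (x y : ℕ) (M : Type*) [AddCommGroup M] [Module k M]
    [Module (Alg T)ᵐᵒᵖ M] [IsScalarTower k (Alg T)ᵐᵒᵖ M] where
  u : M
  v : M
  φ : M →ₗ[k] k
  ψ : M →ₗ[k] k
  hx : x < T.ℓ i₀
  hy : 0 < y
  hyℓ : y ≤ T.ℓ i₀
  ev_u : ev T .src u = u
  ev_v : ev T (vx T i₀ y) v = v
  pth_u : pth T i₀ 0 (x + 1) u = 0
  pth_v : pth T i₀ y (T.ℓ i₀) v = pth T i₂ 0 (T.ℓ i₂) u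
  φ_u : φ (pth T i₂ 0 (T.ℓ i₂) u) = 1
  φ_pth : ∀ m, φ (pth T i₀ (y - 1) (T.ℓ i₀) m) = 0
  ψ_pth : ∀ m, ψ (pth T i₀ 0 x (ev T .src m)) = φ (pth T i₂ 0 (T.ℓ i₂) m)
  ψ_v : y ≤ x → ψ (pth T i₀ y x v) = 0

/-- An element of `M` generating a representation supported on the vertices `a, …, b` of the
branch `i`, together with a linear form splitting it off. -/
structure SplitElt (i : Fin T.t) (a b : ℕ) (M : Type*) [AddCommGroup M] [Module k M]
    [Module (Alg T)ᵐᵒᵖ M] [IsScalarTower k (Alg T)ᵐᵒᵖ M] where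
  u : M
  φ : M →ₗ[k] k
  ha : 0 < a
  hab : a ≤ b
  hb : b < T.ℓ i
  ev_u : ev T (vx T i a) u = u
  pth_u : pth T i a (b + 1) u = 0
  φ_u : φ (pth T i a b u) = 1
  φ_pth : ∀ m, φ (pth T i (a - 1) b m) = 0

variable {T}
variable {M N : Type*} [AddCommGroup M] [Module k M] [Module (Alg T)ᵐᵒᵖ M]
  [IsScalarTower k (Alg T)ᵐᵒᵖ M] [AddCommGroup N] [Module k N] [Module (Alg T)ᵐᵒᵖ N]
  [IsScalarTower k (Alg T)ᵐᵒᵖ N]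

lemma BranchRel.pth_zero {i₀ i₂ : Fin T.t} {c : Fin T.t → k} (h : BranchRel T i₀ i₂ c) (m : M) :
    pth T i₀ 0 (T.ℓ i₀) m = 0 := by
  have := (mkA_eq_zero T).2 h.mem
  rw [wE] at this
  rw [pth, act_apply, this, op_zero, zero_smul]

lemma BranchRel.pth_eq {i₀ i₂ : Fin T.t} {c : Fin T.t → k} (h : BranchRel T i₀ i₂ c)
    {j : Fin T.t} (hj : j ≠ i₀) (m : M) :
    pth T j 0 (T.ℓ j) m = c j • pth T i₂ 0 (T.ℓ i₂) m := by
  rw [pth, pth, act_apply, act_apply, ← smul_assoc, ← op_smul]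
  congr 2
  exact h.eq j hj

/-- Homomorphisms between modules with split pairs of the same type. -/
lemma SplitPair.exists_hom {i₀ i₂ : Fin T.t} {c : Fin T.t → k} (h : BranchRel T i₀ i₂ c) {x y : ℕ}
    (p : SplitPair T i₀ i₂ x y M) (q : SplitPair T i₀ i₂ x y N) :
    ∃ f : M →ₗ[(Alg T)ᵐᵒᵖ] N, f p.u = q.u ∧ f p.v = q.v ∧
      (∀ m, f m ∈ Submodule.span (Alg T)ᵐᵒᵖ {q.u, q.v}) ∧
      ∀ m, f (ev T .src m) = p.φ (pth T i₂ 0 (T.ℓ i₂) m) • q.u := by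
  have hy := p.hy
  have hx := p.hx
  let g₀ : ℕ → (M →ₗ[k] N) := fun a =>
    (if a ≤ x then (p.ψ ∘ₗ pth T i₀ a x).smulRight (pth T i₀ 0 a q.u) else 0) +
      (if y ≤ a then (p.φ ∘ₗ pth T i₀ a (T.ℓ i₀)).smulRight (pth T i₀ y a q.v) else 0)
  let g : Fin T.t → ℕ → (M →ₗ[k] N) := fun j a => if j = i₀ then g₀ a else
    (c j)⁻¹ • (p.φ ∘ₗ pth T j a (T.ℓ j)).smulRight (pth T j 0 a q.u)
  have hg₀ : ∀ a m, g i₀ a m = (if a ≤ x then p.ψ (pth T i₀ a x m) • pth T i₀ 0 a q.u else 0) +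
      (if y ≤ a then p.φ (pth T i₀ a (T.ℓ i₀) m) • pth T i₀ y a q.v else 0) := by
    intro a m
    simp only [g, g₀, if_true, LinearMap.add_apply]
    split_ifs <;> simp
  have hg : ∀ j, j ≠ i₀ → ∀ a m,
      g j a m = (c j)⁻¹ • p.φ (pth T j a (T.ℓ j) m) • pth T j 0 a q.u := by
    intro j hj a m
    simp [g, hj]
  have hsrc : ∀ j m, g j 0 (ev T .src m) = p.φ (pth T i₂ 0 (T.ℓ i₂) m) • q.u := by
    intro j m
    by_cases hj : j = i₀
    · subst hj
      rw [hg₀, if_pos (Nat.zero_le _), if_neg (by omega), p.ψ_pth, pth_self, add_zero]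
    · rw [hg j hj, pth_self, ← vtx_zero j, pth_ev T j (T.hℓ j), h.pth_eq hj, map_smul, smul_smul,
        smul_eq_mul, inv_mul_cancel_left₀ (h.c_ne j hj)]
  have hsnk : ∀ j m, g j (T.ℓ j) m = p.φ m • pth T i₂ 0 (T.ℓ i₂) q.u := by
    intro j m
    by_cases hj : j = i₀
    · subst hj
      rw [hg₀, if_neg (by omega), if_pos p.hyℓ, pth_self, q.pth_v, zero_add]
    · rw [hg j hj, pth_self, h.pth_eq hj, smul_comm (p.φ m), inv_smul_smul₀ (h.c_ne j hj)]
  have hmem : ∀ j a m, g j a m ∈ Submodule.span (Alg T)ᵐᵒᵖ {q.u, q.v} := by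
    have hu : q.u ∈ Submodule.span (Alg T)ᵐᵒᵖ {q.u, q.v} := Submodule.subset_span (by simp)
    have hv : q.v ∈ Submodule.span (Alg T)ᵐᵒᵖ {q.u, q.v} := Submodule.subset_span (by simp)
    intro j a m
    by_cases hj : j = i₀
    · subst hj
      rw [hg₀]
      refine add_mem ?_ ?_ <;> split_ifs <;>
        first | exact zero_mem _ | exact scalar_mem _ _ (act_mem _ _ (by assumption))
    · rw [hg j hj]
      exact scalar_mem _ _ (scalar_mem _ _ (act_mem _ _ hu))
  obtain ⟨f, hf⟩ := exists_glue g (fun i j m => by rw [hsrc, hsrc])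
    (fun i j m => by rw [hsnk, hsnk]) (fun j a ha m => by
      by_cases hj : j = i₀
      · subst hj
        rw [hg₀, hg₀, map_add, map_add]
        congr 1
        · rcases lt_trichotomy a x with hax | rfl | hax
          · rw [if_pos (by omega), if_pos hax.le, map_smul, map_smul, pth_ar T j hax,
              pth_ev T j hax, pth_succ T j (Nat.zero_le _), ev_ar]
          · rw [if_neg (by omega), if_pos le_rfl, map_smul, map_zero,
              ← pth_succ T j (Nat.zero_le _), q.pth_u, smul_zero]
          · rw [if_neg (by omega), if_neg (by omega), map_zero, map_zero]
        · rcases lt_trichotomy y (a + 1) with hay | rfl | hay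
          · rw [if_pos hay.le, if_pos (by omega), map_smul, map_smul, pth_ar T j ha, pth_ev T j ha,
              pth_succ T j (by omega), ev_ar]
          · rw [if_pos le_rfl, if_neg (by omega), pth_ar T j ha, map_zero]
            have := p.φ_pth m
            rw [Nat.add_sub_cancel] at this
            rw [this, zero_smul, map_zero]
          · rw [if_neg (by omega), if_neg (by omega), map_zero, map_zero]
      · rw [hg j hj, hg j hj, pth_ar T j ha, pth_ev T j ha, map_smul, map_smul, map_smul, map_smul,
          pth_succ T j (Nat.zero_le _), ev_ar])
  have hfsrc : ∀ m, f (ev T .src m) = p.φ (pth T i₂ 0 (T.ℓ i₂) m) • q.u := by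
    intro m
    have := hf i₀ 0 (Nat.zero_le _) m
    rw [vx, vtx_zero] at this
    rw [this, hsrc, map_smul, q.ev_u]
  refine ⟨f, ?_, ?_, fun m => mem_of_ev T _ fun i a ha => ?_, hfsrc⟩
  · rw [← p.ev_u, hfsrc, p.φ_u, one_smul]
  · rw [← p.ev_v, hf i₀ y p.hyℓ, p.ev_v, hg₀, if_pos le_rfl, p.pth_v, p.φ_u, pth_self, one_smul,
      map_add, q.ev_v]
    split_ifs with hyx
    · rw [p.ψ_v hyx, zero_smul, map_zero, zero_add]
    · rw [map_zero, zero_add]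
  · rw [← map_ev, hf i a ha]
    exact act_mem _ _ (hmem _ _ _)

/-- Homomorphisms between modules with split elements of the same type. -/
lemma SplitElt.exists_hom {i : Fin T.t} {a b : ℕ} (p : SplitElt T i a b M)
    (q : SplitElt T i a b N) :
    ∃ f : M →ₗ[(Alg T)ᵐᵒᵖ] N, f p.u = q.u ∧
      ∀ m, f m ∈ Submodule.span (Alg T)ᵐᵒᵖ {q.u, 0} := by
  have ha := p.ha
  have hab := p.hab
  have hb := p.hb
  let g : Fin T.t → ℕ → (M →ₗ[k] N) := fun j d => if j = i ∧ a ≤ d ∧ d ≤ b then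
    (p.φ ∘ₗ pth T i d b).smulRight (pth T i a d q.u) else 0
  have hg : ∀ j d m, g j d m = if j = i ∧ a ≤ d ∧ d ≤ b then
      p.φ (pth T i d b m) • pth T i a d q.u else 0 := by
    intro j d m
    simp only [g]
    split_ifs <;> simp
  obtain ⟨f, hf⟩ := exists_glue g
    (fun j j' m => by rw [hg, hg, if_neg (by omega), if_neg (by omega)])
    (fun j j' m => by
      rw [hg, hg, if_neg (by rintro ⟨rfl, h⟩; omega), if_neg (by rintro ⟨rfl, h⟩; omega)])
    (fun j d hd m => by
      rw [hg, hg]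
      by_cases hj : j = i
      · subst hj
        simp only [true_and]
        rcases lt_trichotomy d b with hdb | rfl | hdb
        · rcases lt_trichotomy a (d + 1) with had | rfl | had
          · rw [if_pos (by omega), if_pos (by omega), pth_ar T j hdb, pth_ev T j hdb, map_smul,
              map_smul, pth_succ T j (by omega), ev_ar]
          · have := p.φ_pth m
            rw [Nat.add_sub_cancel] at this
            rw [if_pos (by omega), if_neg (by omega), pth_ar T j hdb, this, zero_smul, map_zero,
              map_zero]
          · rw [if_neg (by omega), if_neg (by omega), map_zero, map_zero]
        · rw [if_neg (by omega), if_pos (by omega), map_smul, ← pth_succ T j hab, q.pth_u,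
            map_zero, smul_zero]
        · rw [if_neg (by omega), if_neg (by omega), map_zero, map_zero]
      · rw [if_neg (by tauto), if_neg (by tauto), map_zero, map_zero])
  refine ⟨f, ?_, fun m => mem_of_ev T _ fun j d hd => ?_⟩
  · rw [← p.ev_u, hf i a (by omega), p.ev_u, hg, if_pos ⟨rfl, le_rfl, hab⟩, p.φ_u, pth_self,
      one_smul, q.ev_u]
  · rw [← map_ev, hf j d hd, hg]
    refine act_mem _ _ ?_
    split_ifs
    · exact scalar_mem _ _ (act_mem _ _ (Submodule.subset_span (by simp)))
    · exact zero_mem _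

omit [Module k M] [IsScalarTower k (Alg T)ᵐᵒᵖ M] [Module k N]
  [IsScalarTower k (Alg T)ᵐᵒᵖ N] in
lemma comp_eq_id_of_span
    (hI : ∀ f : M →ₗ[(Alg T)ᵐᵒᵖ] M, f ∘ₗ f = f → f = 0 ∨ f = LinearMap.id)
    (f : M →ₗ[(Alg T)ᵐᵒᵖ] N) (g : N →ₗ[(Alg T)ᵐᵒᵖ] M) {u v : M} (hu0 : u ≠ 0)
    (hu : g (f u) = u) (hv : g (f v) = v)
    (hg : ∀ n, g n ∈ Submodule.span (Alg T)ᵐᵒᵖ {u, v}) : g ∘ₗ f = LinearMap.id := by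
  have key : ∀ m ∈ Submodule.span (Alg T)ᵐᵒᵖ {u, v}, g (f m) = m := by
    intro m hm
    have : Set.EqOn (g ∘ₗ f) (LinearMap.id : M →ₗ[(Alg T)ᵐᵒᵖ] M) {u, v} := by
      rintro _ (rfl | rfl)
      · exact hu
      · exact hv
    exact LinearMap.eqOn_span this hm
  refine (hI _ (LinearMap.ext fun m => key _ (hg _))).resolve_left fun h => hu0 ?_
  rw [← hu]
  exact LinearMap.congr_fun h u

lemma SplitPair.u_ne_zero {i₀ i₂ : Fin T.t} {x y : ℕ} (p : SplitPair T i₀ i₂ x y M) :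
    p.u ≠ 0 := by
  intro h
  have := p.φ_u
  simp [h] at this

lemma SplitElt.u_ne_zero {i : Fin T.t} {a b : ℕ} (p : SplitElt T i a b M) : p.u ≠ 0 := by
  intro h
  have := p.φ_u
  simp [h] at this

lemma SplitPair.nonempty_equiv {i₀ i₂ : Fin T.t} {c : Fin T.t → k} (h : BranchRel T i₀ i₂ c)
    {x y : ℕ} (hM : ∀ f : M →ₗ[(Alg T)ᵐᵒᵖ] M, f ∘ₗ f = f → f = 0 ∨ f = LinearMap.id)
    (hN : ∀ f : N →ₗ[(Alg T)ᵐᵒᵖ] N, f ∘ₗ f = f → f = 0 ∨ f = LinearMap.id)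
    (p : SplitPair T i₀ i₂ x y M) (q : SplitPair T i₀ i₂ x y N) :
    Nonempty (M ≃ₗ[(Alg T)ᵐᵒᵖ] N) := by
  obtain ⟨f, hfu, hfv, hf, -⟩ := p.exists_hom h q
  obtain ⟨g, hgu, hgv, hg, -⟩ := q.exists_hom h p
  exact ⟨LinearEquiv.ofLinearMap f g
    (comp_eq_id_of_span hN g f q.u_ne_zero (by rw [hgu, hfu]) (by rw [hgv, hfv]) hf)
    (comp_eq_id_of_span hM f g p.u_ne_zero (by rw [hfu, hgu]) (by rw [hfv, hgv]) hg)⟩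

lemma SplitElt.nonempty_equiv {i : Fin T.t} {a b : ℕ}
    (hM : ∀ f : M →ₗ[(Alg T)ᵐᵒᵖ] M, f ∘ₗ f = f → f = 0 ∨ f = LinearMap.id)
    (hN : ∀ f : N →ₗ[(Alg T)ᵐᵒᵖ] N, f ∘ₗ f = f → f = 0 ∨ f = LinearMap.id)
    (p : SplitElt T i a b M) (q : SplitElt T i a b N) : Nonempty (M ≃ₗ[(Alg T)ᵐᵒᵖ] N) := by
  obtain ⟨f, hfu, hf⟩ := p.exists_hom q
  obtain ⟨g, hgu, hg⟩ := q.exists_hom p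
  exact ⟨LinearEquiv.ofLinearMap f g
    (comp_eq_id_of_span hN g f q.u_ne_zero (by rw [hgu, hfu]) (by rw [map_zero, map_zero]) hf)
    (comp_eq_id_of_span hM f g p.u_ne_zero (by rw [hfu, hgu]) (by rw [map_zero, map_zero]) hg)⟩

/-- An indecomposable module with a split pair is generated by it, and the relevant branch acts
injectively at the source. -/
lemma SplitPair.indec {i₀ i₂ : Fin T.t} {c : Fin T.t → k} (h : BranchRel T i₀ i₂ c)
    {x y : ℕ} (hM : ∀ f : M →ₗ[(Alg T)ᵐᵒᵖ] M, f ∘ₗ f = f → f = 0 ∨ f = LinearMap.id)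
    (p : SplitPair T i₀ i₂ x y M) :
    Submodule.span (Alg T)ᵐᵒᵖ {p.u, p.v} = ⊤ ∧
      ∀ m : M, pth T i₂ 0 (T.ℓ i₂) m = 0 → ev T .src m = 0 := by
  obtain ⟨f, hfu, hfv, hf, hs⟩ := p.exists_hom h p
  have hid : f = LinearMap.id :=
    comp_eq_id_of_span hM LinearMap.id f p.u_ne_zero (by simpa using hfu) (by simpa using hfv) hf
  subst hid
  refine ⟨eq_top_iff.2 fun m _ => hf m, fun m hm => ?_⟩
  have := hs m
  rwa [hm, map_zero, zero_smul] at this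

/-- If the relevant branch acts nontrivially then there is a split pair. -/
lemma exists_splitPair {i₀ i₂ : Fin T.t} {c : Fin T.t → k} (h : BranchRel T i₀ i₂ c)
    {m : M} (hm : pth T i₂ 0 (T.ℓ i₂) m ≠ 0) :
    ∃ x < T.ℓ i₀, ∃ y ≤ T.ℓ i₀, Nonempty (SplitPair T i₀ i₂ x y M) := by
  have hw : ∀ m : M, pth T i₂ 0 (T.ℓ i₂) (ev T .src m) = pth T i₂ 0 (T.ℓ i₂) m :=
    pth_ev T i₂ (T.hℓ i₂)
  have hℓ := T.hℓ i₀
  have hex : ∃ x, ∃ u : M, ev T .src u = u ∧ pth T i₀ 0 (x + 1) u = 0 ∧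
      pth T i₂ 0 (T.ℓ i₂) u ≠ 0 :=
    ⟨T.ℓ i₀ - 1, ev T .src m, ev_self T _ _, by rw [Nat.sub_add_cancel hℓ, h.pth_zero],
      by rwa [hw]⟩
  obtain ⟨x, ⟨u, hu, hxu, hwu⟩, hxmin⟩ : ∃ x, (∃ u : M, ev T .src u = u ∧
      pth T i₀ 0 (x + 1) u = 0 ∧ pth T i₂ 0 (T.ℓ i₂) u ≠ 0) ∧ ∀ x' < x, ¬ ∃ u : M,
      ev T .src u = u ∧ pth T i₀ 0 (x' + 1) u = 0 ∧ pth T i₂ 0 (T.ℓ i₂) u ≠ 0 :=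
    ⟨Nat.find hex, Nat.find_spec hex, fun x' hx' => Nat.find_min hex hx'⟩
  have hx : x < T.ℓ i₀ := by
    by_contra hx
    exact hxmin (T.ℓ i₀ - 1) (by omega) ⟨u, hu, by rw [Nat.sub_add_cancel hℓ, h.pth_zero], hwu⟩
  have hey : ∃ y, y ≤ T.ℓ i₀ ∧ ∃ v : M, ev T (vx T i₀ y) v = v ∧
      pth T i₀ y (T.ℓ i₀) v = pth T i₂ 0 (T.ℓ i₂) u := by
    refine ⟨T.ℓ i₀, le_rfl, pth T i₂ 0 (T.ℓ i₂) u, ?_, pth_self T _ _ _⟩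
    have := ev_pth T i₂ (T.hℓ i₂) u
    rwa [vx, vtx_snk i₂ (T.hℓ i₂), ← vtx_snk i₀ hℓ] at this
  obtain ⟨y, ⟨hyℓ, v, hv, hvu⟩, hymin⟩ : ∃ y, (y ≤ T.ℓ i₀ ∧ ∃ v : M, ev T (vx T i₀ y) v = v ∧
      pth T i₀ y (T.ℓ i₀) v = pth T i₂ 0 (T.ℓ i₂) u) ∧ ∀ y' < y, ¬ (y' ≤ T.ℓ i₀ ∧ ∃ v : M,
      ev T (vx T i₀ y') v = v ∧ pth T i₀ y' (T.ℓ i₀) v = pth T i₂ 0 (T.ℓ i₂) u) :=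
    ⟨Nat.find hey, Nat.find_spec hey, fun x' hx' => Nat.find_min hey hx'⟩
  have hy : 0 < y := by
    rcases Nat.eq_zero_or_pos y with rfl | hy
    · rw [h.pth_zero] at hvu
      exact absurd hvu.symm hwu
    · exact hy
  obtain ⟨φ, hφ1, hφ0⟩ := exists_dual_eq_one (x := pth T i₂ 0 (T.ℓ i₂) u)
    (p := LinearMap.range (pth T i₀ (y - 1) (T.ℓ i₀) : M →ₗ[k] M)) (by
      rintro ⟨n, hn⟩
      exact hymin (y - 1) (by omega) ⟨by omega, ev T (vx T i₀ (y - 1)) n, ev_self T _ _,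
        by rw [pth_ev T i₀ (by omega), hn]⟩)
  obtain ⟨ψ, hψ, -⟩ := exists_extend_lift (pth T i₀ 0 x ∘ₗ ev T .src : M →ₗ[k] M)
    (φ ∘ₗ pth T i₂ 0 (T.ℓ i₂)) (0 : M →ₗ[k] (Fin 0 → k)) (0 : k →ₗ[k] (Fin 0 → k))
    (fun z => ⟨0, Subsingleton.elim _ _⟩) (fun n => rfl) (fun n hn => by
      rw [LinearMap.comp_apply] at hn ⊢
      suffices pth T i₂ 0 (T.ℓ i₂) (ev T .src n) = 0 by rw [← hw, this, map_zero]
      rcases Nat.eq_zero_or_pos x with rfl | hx0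
      · rw [pth_self] at hn
        rw [hn, map_zero]
      · by_contra hne
        exact hxmin (x - 1) (by omega) ⟨ev T .src n, ev_self T _ _,
          by rwa [Nat.sub_add_cancel hx0], hne⟩)
  simp only [LinearMap.comp_apply] at hψ
  have hψu : ψ (pth T i₀ 0 x u) = 1 := by
    have := hψ u
    rwa [hu, hφ1] at this
  have hφ0' : ∀ n, φ (pth T i₀ (y - 1) (T.ℓ i₀) n) = 0 := fun n => hφ0 _ ⟨n, rfl⟩
  refine ⟨x, hx, y, hyℓ, ?_⟩
  by_cases hyx : y ≤ x
  · refine ⟨⟨u, v - ψ (pth T i₀ y x v) • pth T i₀ 0 y u, φ, ψ, hx, hy, hyℓ, hu, ?_, hxu, ?_, hφ1,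
      hφ0', hψ, fun _ => ?_⟩⟩
    · rw [map_sub, map_smul, hv, ev_pth T i₀ hy]
    · rw [map_sub, map_smul, pth_trans T i₀ (Nat.zero_le _) hyℓ, h.pth_zero, smul_zero, sub_zero,
        hvu]
    · rw [map_sub, map_sub, map_smul, map_smul, pth_trans T i₀ (Nat.zero_le _) hyx, hψu,
        smul_eq_mul, mul_one, sub_self]
  · exact ⟨⟨u, v, φ, ψ, hx, hy, hyℓ, hu, hv, hxu, hvu, hφ1, hφ0', hψ, fun h => absurd h hyx⟩⟩

/-- A nonzero module vanishing at source and sink has a split element. -/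
lemma exists_splitElt [Nontrivial M] (h0 : ∀ m : M, ev T .src m = 0)
    (h1 : ∀ m : M, ev T .snk m = 0) :
    ∃ i, ∃ a < T.ℓ i, ∃ b < T.ℓ i, Nonempty (SplitElt T i a b M) := by
  obtain ⟨i, hi⟩ : ∃ i, ∃ a, a ≤ T.ℓ i ∧ ∃ m : M, ev T (vx T i a) m ≠ 0 := by
    by_contra! hc
    obtain ⟨m, hm⟩ := exists_ne (0 : M)
    exact hm (eq_zero_of_ev T fun i a ha => hc i a ha m)
  obtain ⟨a, ⟨ha, m, hm⟩, hmin⟩ : ∃ a, (a ≤ T.ℓ i ∧ ∃ m : M, ev T (vx T i a) m ≠ 0) ∧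
      ∀ a' < a, ¬ (a' ≤ T.ℓ i ∧ ∃ m : M, ev T (vx T i a') m ≠ 0) :=
    ⟨Nat.find hi, Nat.find_spec hi, fun _ h => Nat.find_min hi h⟩
  have ha0 : 0 < a := by
    rcases Nat.eq_zero_or_pos a with rfl | ha0
    · exact absurd (h0 m) hm
    · exact ha0
  have hal : a < T.ℓ i := by
    refine lt_of_le_of_ne ha ?_
    rintro rfl
    rw [vx, vtx_snk i (T.hℓ i)] at hm
    exact hm (h1 m)
  set u := ev T (vx T i a) m with hu
  have hex : ∃ b, a ≤ b ∧ pth T i a (b + 1) u = 0 := by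
    refine ⟨T.ℓ i - 1, by omega, ?_⟩
    rw [Nat.sub_add_cancel (T.hℓ i), ← ev_pth T i hal, vx, vtx_snk i (T.hℓ i)]
    exact h1 _
  obtain ⟨b, ⟨hab, hbu⟩, hbmin⟩ : ∃ b, (a ≤ b ∧ pth T i a (b + 1) u = 0) ∧
      ∀ b' < b, ¬ (a ≤ b' ∧ pth T i a (b' + 1) u = 0) :=
    ⟨Nat.find hex, Nat.find_spec hex, fun _ h => Nat.find_min hex h⟩
  have hbl : b < T.ℓ i := by
    by_contra hb
    refine hbmin (T.ℓ i - 1) (by have := T.hℓ i; omega) ⟨by omega, ?_⟩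
    rw [Nat.sub_add_cancel (T.hℓ i), ← ev_pth T i hal, vx, vtx_snk i (T.hℓ i)]
    exact h1 _
  have hne : pth T i a b u ≠ 0 := by
    rcases hab.eq_or_lt with rfl | hab
    · rwa [pth_self]
    · intro h
      exact hbmin (b - 1) (by omega) ⟨by omega, by rwa [Nat.sub_add_cancel (by omega)]⟩
  obtain ⟨φ, hφ, -⟩ := exists_dual_eq_one (x := pth T i a b u) (p := (⊥ : Submodule k M))
    (by simpa using hne)
  refine ⟨i, a, hal, b, hbl, ⟨⟨u, φ, ha0, hab, hbl, ev_self T _ _, hbu, hφ, fun n => ?_⟩⟩⟩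
  have : ev T (vx T i (a - 1)) n = 0 := by
    by_contra h
    exact hmin (a - 1) (by omega) ⟨by omega, n, h⟩
  rw [← pth_ev T i (by omega), this, map_zero, map_zero]

end Types

end Toupie

namespace Toupie

section Closure

variable {k : Type u} [Field k] {T : ToupieAlg k}
variable {M N : Type*} [AddCommGroup M] [Module k M] [Module (Alg T)ᵐᵒᵖ M]
  [IsScalarTower k (Alg T)ᵐᵒᵖ M] [AddCommGroup N] [Module k N] [Module (Alg T)ᵐᵒᵖ N]
  [IsScalarTower k (Alg T)ᵐᵒᵖ N]

lemma exists_branchRel (hm : mDim T = 1) (hb : ∃! i : Fin T.t, branchInI T i) :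
    ∃ i₀ i₂ c, BranchRel T i₀ i₂ c := by
  obtain ⟨i₀, h₀, huniq⟩ := hb
  have : Nontrivial (Fin T.t) := Fin.nontrivial_iff_two_le.2 T.ht
  obtain ⟨i₂, h₂⟩ := exists_ne i₀
  have hmem : ∀ j, mkA T (wE j) ∈ LinearMap.range (lrMap T) := by
    intro j
    refine ⟨mkA T (wE j), op_injective ?_⟩
    have h1 := pth_ev T j (T.hℓ j) (1 : (Alg T)ᵐᵒᵖ)
    have h2 := ev_pth T j (T.hℓ j) (1 : (Alg T)ᵐᵒᵖ)
    rw [vx, vtx_zero, pth, ev, act_apply, act_apply, act_apply] at h1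
    rw [vx, vtx_snk j (T.hℓ j), pth, ev, act_apply, act_apply] at h2
    simp only [smul_eq_mul, mul_one] at h1 h2
    change op (e0 T * mkA T (wE j) * einf T) = _
    rw [op_mul, op_mul]
    exact (congrArg _ h1).trans h2
  have hne : (⟨_, hmem i₂⟩ : LinearMap.range (lrMap T)) ≠ 0 := by
    intro h
    exact h₂ (huniq i₂ ((mkA_eq_zero T).1 (congrArg Subtype.val h)))
  have key : ∀ j, ∃ c : k, c • mkA T (wE i₂) = mkA T (wE j) := by
    intro j
    obtain ⟨c, hc⟩ := (finrank_eq_one_iff_of_nonzero' _ hne).1 hm ⟨_, hmem j⟩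
    exact ⟨c, congrArg Subtype.val hc⟩
  choose c hc using key
  refine ⟨i₀, i₂, c, h₂, h₀, fun j hj h => hj (huniq j ((mkA_eq_zero T).1 ?_)),
    fun j _ => (hc j).symm⟩
  rw [← hc, h, zero_smul]

lemma indec_trichotomy {i₀ i₂ : Fin T.t} {c : Fin T.t → k} (h : BranchRel T i₀ i₂ c)
    (hM : ∀ f : M →ₗ[(Alg T)ᵐᵒᵖ] M, f ∘ₗ f = f → f = 0 ∨ f = LinearMap.id) :
    ArrowInj T M ∨ ArrowSurj T M ∨ ((∀ m : M, ev T .src m = 0) ∧ ∀ m : M, ev T .snk m = 0) ∨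
      ∃ x < T.ℓ i₀, ∃ y ≤ T.ℓ i₀, Nonempty (SplitPair T i₀ i₂ x y M) := by
  by_cases hw : ∃ m : M, pth T i₂ 0 (T.ℓ i₂) m ≠ 0
  · obtain ⟨m, hm⟩ := hw
    exact Or.inr (Or.inr (Or.inr (exists_splitPair h hm)))
  · push Not at hw
    have hw' : ∀ i (m : M), pth T i 0 (T.ℓ i) m = 0 := by
      intro i m
      by_cases hi : i = i₀
      · rw [hi, h.pth_zero]
      · rw [h.pth_eq hi, hw, smul_zero]
    rcases src_eq_zero_or_arrowSurj hM hw' with h0 | h0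
    · rcases arrowInj_or_snk_eq_zero hM h0 with h1 | h1
      · exact Or.inl h1
      · exact Or.inr (Or.inr (Or.inl ⟨h0, h1⟩))
    · exact Or.inr (Or.inl h0)

lemma ArrowSurj.hom_eq_zero (hM : ArrowSurj T M) {f : M →ₗ[(Alg T)ᵐᵒᵖ] N}
    (hf : ∀ m, f (ev T .src m) = 0) : f = 0 := by
  refine hom_ext fun i a ha => ?_
  induction a with
  | zero => exact hf
  | succ a ih =>
    intro m
    obtain ⟨m', hm'⟩ := hM.2 i a ha m
    rw [← hm', ← ar_ev, map_ar, ih (by omega), LinearMap.zero_apply, map_zero,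
      LinearMap.zero_apply]

lemma ArrowInj.hom_eq_zero (hN : ArrowInj T N) {f : M →ₗ[(Alg T)ᵐᵒᵖ] N}
    (hf : ∀ m, f (ev T .snk m) = 0) : f = 0 := by
  refine hom_ext fun i a ha => ?_
  induction ha using Nat.decreasingInduction with
  | self =>
    rw [vx, vtx_snk i (T.hℓ i)]
    exact hf
  | of_succ a ha ih =>
    intro m
    rw [map_ev]
    refine hN.2 i a ha _ ?_
    rw [← map_ar, ← ev_ar, ih, LinearMap.zero_apply]

lemma ArrowInj.ev_eq_zero (hM : ArrowInj T M) {i : Fin T.t} {a b : ℕ} (hab : a ≤ b)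
    (hb : b ≤ T.ℓ i) {m : M} (h : pth T i a b m = 0) : ev T (vx T i a) m = 0 := by
  induction b, hab using Nat.le_induction with
  | base => rw [← pth_self T i a m, h, map_zero]
  | succ b hab ih =>
    rcases hab.eq_or_lt with rfl | hab'
    · exact hM.2 i a hb m (by rwa [← pth_one])
    · refine ih (by omega) ?_
      rw [← ev_pth T i hab']
      exact hM.2 i b hb _ (by rwa [← pth_succ T i hab])

lemma ArrowInj.of_hom {i₀ i₂ : Fin T.t} {c : Fin T.t → k} (h : BranchRel T i₀ i₂ c)
    (hM : ∀ f : M →ₗ[(Alg T)ᵐᵒᵖ] M, f ∘ₗ f = f → f = 0 ∨ f = LinearMap.id) (hN : ArrowInj T N)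
    {f : M →ₗ[(Alg T)ᵐᵒᵖ] N} (hf : f ≠ 0) : ArrowInj T M := by
  rcases indec_trichotomy h hM with h1 | h1 | h1 | ⟨x, -, y, -, ⟨p⟩⟩
  · exact h1
  · exact absurd (h1.hom_eq_zero fun m => by rw [map_ev, hN.1]) hf
  · exact absurd (hN.hom_eq_zero fun m => by rw [h1.2, map_zero]) hf
  · have hu : f p.u = 0 := by rw [← p.ev_u, map_ev, hN.1]
    have hv : f p.v = 0 := by
      rw [← p.ev_v, map_ev]
      exact hN.ev_eq_zero p.hyℓ le_rfl (by rw [← map_pth, p.pth_v, map_pth, hu, map_zero])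
    refine absurd (LinearMap.ext_on (p.indec h hM).1 ?_) hf
    rintro _ (rfl | rfl)
    · exact hu
    · exact hv

lemma ArrowSurj.of_hom {i₀ i₂ : Fin T.t} {c : Fin T.t → k} (h : BranchRel T i₀ i₂ c)
    (hN : ∀ f : N →ₗ[(Alg T)ᵐᵒᵖ] N, f ∘ₗ f = f → f = 0 ∨ f = LinearMap.id) (hM : ArrowSurj T M)
    {f : M →ₗ[(Alg T)ᵐᵒᵖ] N} (hf : f ≠ 0) : ArrowSurj T N := by
  rcases indec_trichotomy h hN with h1 | h1 | h1 | ⟨x, -, y, -, ⟨p⟩⟩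
  · exact absurd (hM.hom_eq_zero fun m => by rw [map_ev, h1.1]) hf
  · exact h1
  · exact absurd (hM.hom_eq_zero fun m => by rw [map_ev, h1.1]) hf
  · refine absurd (hM.hom_eq_zero fun m => ?_) hf
    rw [map_ev]
    refine (p.indec h hN).2 _ ?_
    rw [← map_pth, ← ev_pth T i₂ (T.hℓ i₂), vx, vtx_snk i₂ (T.hℓ i₂), hM.1, map_zero]

end Closure

section Laura

open scoped ModuleCat

variable {k : Type u} [Field k] {T : ToupieAlg k}

lemma inLeftPart_of_arrowInj {i₀ i₂ : Fin T.t} {c : Fin T.t → k} (h : BranchRel T i₀ i₂ c)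
    {M : ModuleCat.{u} (Alg T)ᵐᵒᵖ} (hI : Indec (Alg T)ᵐᵒᵖ M) (hF : FdMod (Alg T)ᵐᵒᵖ M)
    (hM : ArrowInj T M) : InLeftPart (Alg T)ᵐᵒᵖ M := by
  refine ⟨hI, hF, fun X _ _ hX => pdLeOne_of_arrowInj X ?_⟩
  induction hX using Relation.ReflTransGen.head_induction_on with
  | refl => exact hM
  | head hs _ ih =>
    obtain ⟨hI', -, hI₁, hF₁, f, hf, -⟩ := hs
    exact (ih hI₁ hF₁).of_hom h hI'.2 hf

lemma inRightPart_of_arrowSurj {i₀ i₂ : Fin T.t} {c : Fin T.t → k} (h : BranchRel T i₀ i₂ c)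
    {M : ModuleCat.{u} (Alg T)ᵐᵒᵖ} (hI : Indec (Alg T)ᵐᵒᵖ M) (hF : FdMod (Alg T)ᵐᵒᵖ M)
    (hM : ArrowSurj T M) : InRightPart (Alg T)ᵐᵒᵖ M := by
  refine ⟨hI, hF, fun X _ _ hX => idLeOne_of_arrowSurj X ?_⟩
  induction hX with
  | refl => exact hM
  | tail _ hs ih =>
    obtain ⟨hI₁, hF₁, hI', -, f, hf, -⟩ := hs
    exact (ih hI₁ hF₁).of_hom h hI'.2 hf

lemma exists_finite_representatives {R : Type u} [Ring R] {ι : Type} [Finite ι]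
    (Q : ι → ModuleCat.{u} R → Prop)
    (hQ : ∀ i M N, Q i M → Q i N → Nonempty (M ≃ₗ[R] N)) :
    ∃ S : Set (ModuleCat.{u} R), S.Finite ∧ ∀ i M, Q i M → ∃ N ∈ S, Nonempty (M ≃ₗ[R] N) := by
  have : Nonempty (ModuleCat.{u} R) := ⟨ModuleCat.of R R⟩
  refine ⟨Set.range fun i => Classical.epsilon (Q i), Set.finite_range _, fun i M hM => ?_⟩
  exact ⟨_, ⟨i, rfl⟩, hQ i _ _ hM (Classical.epsilon_spec ⟨M, hM⟩)⟩

lemma laura_of_branchRel {i₀ i₂ : Fin T.t} {c : Fin T.t → k} (h : BranchRel T i₀ i₂ c) :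
    Laura (Alg T)ᵐᵒᵖ := by
  obtain ⟨S₁, hS₁, h₁⟩ := exists_finite_representatives
    (ι := Fin (T.ℓ i₀) × Fin (T.ℓ i₀ + 1))
    (fun z (M : ModuleCat.{u} (Alg T)ᵐᵒᵖ) => Indec (Alg T)ᵐᵒᵖ M ∧
      Nonempty (SplitPair T i₀ i₂ z.1 z.2 M))
    (fun z M N ⟨hM, ⟨p⟩⟩ ⟨hN, ⟨q⟩⟩ => p.nonempty_equiv h hM.2 hN.2 q)
  obtain ⟨S₂, hS₂, h₂⟩ := exists_finite_representatives
    (ι := Σ i : Fin T.t, Fin (T.ℓ i) × Fin (T.ℓ i))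
    (fun z (M : ModuleCat.{u} (Alg T)ᵐᵒᵖ) => Indec (Alg T)ᵐᵒᵖ M ∧
      Nonempty (SplitElt T z.1 z.2.1 z.2.2 M))
    (fun z M N ⟨hM, ⟨p⟩⟩ ⟨hN, ⟨q⟩⟩ => p.nonempty_equiv hM.2 hN.2 q)
  refine ⟨S₁ ∪ S₂, hS₁.union hS₂, fun M hI hF hL hR => ?_⟩
  rcases indec_trichotomy (M := M) h hI.2 with h' | h' | h' | ⟨x, hx, y, hy, hp⟩
  · exact absurd (inLeftPart_of_arrowInj h hI hF h') hL
  · exact absurd (inRightPart_of_arrowSurj h hI hF h') hR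
  · have := hI.1
    obtain ⟨i, a, ha, b, hb, hp⟩ := exists_splitElt h'.1 h'.2
    obtain ⟨N, hN, e⟩ := h₂ ⟨i, ⟨a, ha⟩, ⟨b, hb⟩⟩ M ⟨hI, hp⟩
    exact ⟨N, Or.inr hN, e⟩
  · obtain ⟨N, hN, e⟩ := h₁ (⟨x, hx⟩, ⟨y, Nat.lt_succ_of_le hy⟩) M ⟨hI, hp⟩
    exact ⟨N, Or.inl hN, e⟩

end Laura

end Toupie

namespace Toupie

/-- A non simply connected toupie algebra with
`m = dim_k e₀ A e∞ = 1`, exactly one branch of which lies in the ideal `I`, is a laura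
algebra. -/
theorem laura_of_unique_branch_in_ideal {k : Type u} [Field k] (T : ToupieAlg k)
    (hnsc : ¬ SimplyConnected T) (hm : mDim T = 1)
    (hb : ∃! i : Fin T.t, branchInI T i) :
    Laura (Alg T)ᵐᵒᵖ := by
  obtain ⟨i₀, i₂, c, h⟩ := exists_branchRel hm hb
  exact laura_of_branchRel h

end Toupie
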